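/- arXiv:0804.1687 — 6 statements merged into one kernel-verified Lean document; each statement's English description precedes it below -/
import Mathlib

section
/- Let K be a field, f ∈ K(x) nonconstant and in normal form, Ω an algebraic closure of K, and let F be the intermediate field of Ω/K obtained by adjoining to K all roots in Ω of f.num and of f.denom (the splitting field of {f.num, f.denom} inside Ω). Then for every decomposition f_Ω = g∘h of the image f_Ω of f in Ω(x), with g, h ∈ Ω(x) nonconstant, there exists a unit u ∈ Ω(x) (with compositional inverse u⁻¹) such that all coefficients of the numerators and denominators of g∘u⁻¹ and of u∘h lie in F. -/
open Polynomial

/-- The degree of a rational function. -/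
noncomputable def RatFunc.deg {K : Type*} [Field K] (f : RatFunc K) : ℕ :=
  max f.num.natDegree f.denom.natDegree

/-- Composition of rational functions: `g.comp h = g ∘ h`. -/
noncomputable def RatFunc.comp {K : Type*} [Field K] (g h : RatFunc K) : RatFunc K :=
  (Polynomial.aeval h g.num) / (Polynomial.aeval h g.denom)

/-- A rational function is in normal form if the degree of its numerator is larger than
the degree of its denominator and `0` is a root of the numerator. -/
def RatFunc.IsNormalForm {K : Type*} [Field K] (f : RatFunc K) : Prop :=
  f.denom.natDegree < f.num.natDegree ∧ f.num.eval 0 = 0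

namespace Polynomial

/-- The homogenization of `p`, up to a power of its second argument, evaluated at `(A, B)`, for a
polynomial `p` that splits. -/
noncomputable def homogRoots {k : Type*} [Field k] (p A B : k[X]) : k[X] :=
  C p.leadingCoeff * (p.roots.map fun r ↦ A - C r * B).prod

section Homogenization

variable {L : Type*} [Field L] {A B p q : L[X]}

theorem monic_sub_C_mul (hA : A.Monic) (hdeg : B.natDegree < A.natDegree) (r : L) :
    (A - C r * B).Monic :=
  hA.sub_of_left (degree_lt_degree ((natDegree_C_mul_le r B).trans_lt hdeg))

theorem natDegree_sub_C_mul (hdeg : B.natDegree < A.natDegree) (r : L) :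
    (A - C r * B).natDegree = A.natDegree :=
  natDegree_sub_eq_left_of_natDegree_lt ((natDegree_C_mul_le r B).trans_lt hdeg)

theorem monic_prod_sub_C_mul (hA : A.Monic) (hdeg : B.natDegree < A.natDegree) (s : Multiset L) :
    (s.map fun r ↦ A - C r * B).prod.Monic :=
  monic_multiset_prod_of_monic _ _ fun r _ ↦ monic_sub_C_mul hA hdeg r

theorem leadingCoeff_homogRoots (hA : A.Monic) (hdeg : B.natDegree < A.natDegree) :
    (p.homogRoots A B).leadingCoeff = p.leadingCoeff := by
  rw [homogRoots, leadingCoeff_mul, leadingCoeff_C,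
    (monic_prod_sub_C_mul hA hdeg _).leadingCoeff, mul_one]

theorem sub_C_mul_dvd_homogRoots {r : L} (hr : r ∈ p.roots) :
    A - C r * B ∣ p.homogRoots A B :=
  (Multiset.dvd_prod (Multiset.mem_map_of_mem _ hr)).mul_left _

theorem exists_eval_sub_C_mul_eq_zero (hp : p ≠ 0) {x : L}
    (hx : (p.homogRoots A B).eval x = 0) : ∃ r ∈ p.roots, (A - C r * B).eval x = 0 := by
  rw [homogRoots, eval_mul, eval_C, mul_eq_zero, or_iff_right (leadingCoeff_ne_zero.2 hp),
    ← coe_evalRingHom, map_multiset_prod, Multiset.prod_eq_zero_iff, Multiset.map_map] at hx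
  simpa using hx

variable [IsAlgClosed L]

theorem natDegree_homogRoots (hA : A.Monic) (hdeg : B.natDegree < A.natDegree) (hp : p ≠ 0) :
    (p.homogRoots A B).natDegree = p.natDegree * A.natDegree := by
  rw [homogRoots, natDegree_C_mul (leadingCoeff_ne_zero.2 hp), natDegree_multiset_prod_of_monic]
  · rw [(IsAlgClosed.splits p).natDegree_eq_card_roots, Multiset.map_map]
    simp [natDegree_sub_C_mul hdeg]
  · exact Multiset.forall_mem_map_iff.2 fun r _ ↦ monic_sub_C_mul hA hdeg r

theorem aeval_div_mul_pow_natDegree (hB : B ≠ 0) :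
    aeval (algebraMap L[X] (RatFunc L) A / algebraMap L[X] (RatFunc L) B) p *
      algebraMap L[X] (RatFunc L) B ^ p.natDegree =
      algebraMap L[X] (RatFunc L) (p.homogRoots A B) := by
  have hB' : algebraMap L[X] (RatFunc L) B ≠ 0 := RatFunc.algebraMap_ne_zero hB
  have hpow : algebraMap L[X] (RatFunc L) B ^ p.natDegree =
      (p.roots.map fun _ ↦ algebraMap L[X] (RatFunc L) B).prod := by
    simp [(IsAlgClosed.splits p).natDegree_eq_card_roots]
  rw [hpow]
  conv_lhs => enter [1]; rw [(IsAlgClosed.splits p).eq_prod_roots]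
  rw [homogRoots, map_mul, map_mul, map_multiset_prod, map_multiset_prod, mul_assoc,
    Multiset.map_map, Multiset.map_map, ← Multiset.prod_map_mul]
  congr 1
  · simp [RatFunc.algebraMap_eq_C]
  · congr 1
    refine Multiset.map_congr rfl fun r _ ↦ ?_
    simp [RatFunc.algebraMap_eq_C, sub_mul, hB']

theorem isCoprime_homogRoots_right (hAB : IsCoprime A B) (hp : p ≠ 0) :
    IsCoprime (p.homogRoots A B) B := by
  rw [isCoprime_iff_aeval_ne_zero_of_isAlgClosed L L] at hAB ⊢
  simp only [coe_aeval_eq_eval] at hAB ⊢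
  intro x
  by_contra! hx
  obtain ⟨r, -, hr⟩ := exists_eval_sub_C_mul_eq_zero hp hx.1
  have hA : A.eval x = 0 := by simpa [hx.2] using hr
  exact (hAB x).elim (· hA) (· hx.2)

theorem isCoprime_homogRoots (hAB : IsCoprime A B) (hpq : IsCoprime p q) (hp : p ≠ 0)
    (hq : q ≠ 0) : IsCoprime (p.homogRoots A B) (q.homogRoots A B) := by
  rw [isCoprime_iff_aeval_ne_zero_of_isAlgClosed L L] at hAB hpq ⊢
  simp only [coe_aeval_eq_eval] at hAB hpq ⊢
  intro x
  by_contra! hx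
  obtain ⟨r, hr, hrx⟩ := exists_eval_sub_C_mul_eq_zero hp hx.1
  obtain ⟨s, hs, hsx⟩ := exists_eval_sub_C_mul_eq_zero hq hx.2
  simp only [eval_sub, eval_mul, eval_C] at hrx hsx
  have hB : B.eval x ≠ 0 := fun hB ↦
    (hAB x).elim (· (by simpa [hB] using hrx)) (· hB)
  have hrs : r = s := mul_right_cancel₀ hB (by linear_combination hsx - hrx)
  subst hrs
  exact (hpq r).elim (· (isRoot_of_mem_roots hr)) (· (isRoot_of_mem_roots hs))

end Homogenization

section Lifts

variable {k L : Type*} [Field k] [Field L] {φ : k →+* L}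

theorem prod_X_sub_C_mem_liftsRing {s : Multiset L} (hs : ∀ r ∈ s, r ∈ φ.range) :
    (s.map fun r ↦ X - C r).prod ∈ liftsRing φ := by
  refine multiset_prod_mem _ fun D hD ↦ ?_
  obtain ⟨r, hr, rfl⟩ := Multiset.mem_map.1 hD
  exact sub_mem ((lifts_iff_liftsRing φ _).1 (X_mem_lifts φ))
    ((lifts_iff_liftsRing φ _).1 (C'_mem_lifts (hs r hr)))

theorem mem_range_of_C_mul_mem_liftsRing {B : L[X]} (hB : B.Monic) {r : L}
    (h : C r * B ∈ liftsRing φ) : r ∈ φ.range := by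
  have := (lifts_iff_coeff_lifts _).1 ((lifts_iff_liftsRing φ _).2 h) B.natDegree
  simpa [coeff_C_mul, hB.coeff_natDegree] using this

variable [IsAlgClosed L]

theorem Monic.mem_liftsRing_of_dvd {D P : L[X]} (hD : D.Monic) (hP : P ≠ 0) (hDP : D ∣ P)
    (hroots : ∀ r ∈ P.roots, r ∈ φ.range) : D ∈ liftsRing φ := by
  rw [(IsAlgClosed.splits D).eq_prod_roots_of_monic hD]
  exact prod_X_sub_C_mem_liftsRing fun r hr ↦
    hroots r (Multiset.mem_of_le (roots.le_of_dvd hP hDP) hr)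

theorem comp_X_add_C_mem_liftsRing {G : L[X]} (a : L) (hlc : G.leadingCoeff ∈ φ.range)
    (hroots : ∀ r ∈ G.roots, r - a ∈ φ.range) : G.comp (X + C a) ∈ liftsRing φ := by
  have hG : G.comp (X + C a) =
      C G.leadingCoeff * ((G.roots.map (· - a)).map fun r ↦ X - C r).prod := by
    conv_lhs => rw [(IsAlgClosed.splits G).eq_prod_roots]
    rw [mul_comp, C_comp, multiset_prod_comp, Multiset.map_map, Multiset.map_map]
    congr 2
    refine Multiset.map_congr rfl fun r _ ↦ ?_
    simp
    ring
  rw [hG]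
  refine mul_mem ((lifts_iff_liftsRing φ _).1 (C'_mem_lifts hlc))
    (prod_X_sub_C_mem_liftsRing (Multiset.forall_mem_map_iff.2 hroots))

/-- Let `P / Q = (G / H) ∘ (A / B)` be reduced fractions over an algebraically closed field such
that `P / Q` and `A / B` map `∞` to `∞` and `P / Q` maps `0` to `0`. If the leading coefficient of
`P` and all the roots of `P` and `Q` lie in a subfield, then after a translation so do all
coefficients of `A`, `B`, `G` and `H`. -/
theorem exists_translate_mem_liftsRing {A B G H P Q : L[X]} (hAB : IsCoprime A B)
    (hGH : IsCoprime G H) (hPQ : IsCoprime P Q) (hA : A.Monic) (hB : B.Monic) (hH : H.Monic)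
    (hQ : Q.Monic) (hdeg : B.natDegree < A.natDegree) (hdeg' : Q.natDegree < P.natDegree)
    (hP0 : P.eval 0 = 0) (hlc : P.leadingCoeff ∈ φ.range)
    (hProots : ∀ r ∈ P.roots, r ∈ φ.range) (hQroots : ∀ r ∈ Q.roots, r ∈ φ.range)
    (hcomp : algebraMap L[X] (RatFunc L) P / algebraMap L[X] (RatFunc L) Q =
      aeval (algebraMap L[X] (RatFunc L) A / algebraMap L[X] (RatFunc L) B) G /
        aeval (algebraMap L[X] (RatFunc L) A / algebraMap L[X] (RatFunc L) B) H) :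
    ∃ a : L, A - C a * B ∈ liftsRing φ ∧ B ∈ liftsRing φ ∧
      G.comp (X + C a) ∈ liftsRing φ ∧ H.comp (X + C a) ∈ liftsRing φ := by
  have hP : P ≠ 0 := by rintro rfl; simp at hdeg'
  have hG : G ≠ 0 := by
    rintro rfl
    simp [hP, hQ.ne_zero] at hcomp
  have hGhom := leadingCoeff_homogRoots (p := G) hA hdeg
  have hHhom := leadingCoeff_homogRoots (p := H) hA hdeg
  have hG' : G.homogRoots A B ≠ 0 := by
    rw [← leadingCoeff_ne_zero, hGhom]; exact leadingCoeff_ne_zero.2 hG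
  have hH' : (H.homogRoots A B).Monic := hHhom.trans hH
  have key : P * (H.homogRoots A B * B ^ G.natDegree) =
      Q * (G.homogRoots A B * B ^ H.natDegree) := by
    apply RatFunc.algebraMap_injective L
    have hB' := RatFunc.algebraMap_ne_zero hB.ne_zero
    have hQ' := RatFunc.algebraMap_ne_zero hQ.ne_zero
    have hH'' := RatFunc.algebraMap_ne_zero hH'.ne_zero
    simp only [map_mul, map_pow, ← aeval_div_mul_pow_natDegree hB.ne_zero] at hH'' ⊢
    rw [div_eq_div_iff hQ' (left_ne_zero_of_mul hH'')] at hcomp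
    linear_combination (algebraMap L[X] (RatFunc L) B ^ G.natDegree *
      algebraMap L[X] (RatFunc L) B ^ H.natDegree) * hcomp
  have hlt : H.natDegree < G.natDegree := by
    have h := congrArg natDegree key
    rw [natDegree_mul hP (hH'.mul (hB.pow _)).ne_zero,
      natDegree_mul hQ.ne_zero (mul_ne_zero hG' (hB.pow _).ne_zero),
      natDegree_mul hH'.ne_zero (hB.pow _).ne_zero, natDegree_mul hG' (hB.pow _).ne_zero,
      natDegree_homogRoots hA hdeg hG, natDegree_homogRoots hA hdeg hH.ne_zero,
      natDegree_pow, natDegree_pow] at h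
    by_contra! hle
    nlinarith [Nat.mul_le_mul hle hdeg.le]
  obtain ⟨d, hd⟩ := Nat.exists_eq_add_of_lt hlt
  have key' : P * (H.homogRoots A B * B ^ (d + 1)) = Q * G.homogRoots A B := by
    refine mul_right_cancel₀ (hB.pow H.natDegree).ne_zero ?_
    rw [hd] at key
    linear_combination key
  have hcop : IsCoprime (G.homogRoots A B) (H.homogRoots A B * B ^ (d + 1)) :=
    (isCoprime_homogRoots hAB hGH hG hH.ne_zero).mul_right
      (isCoprime_homogRoots_right hAB hG).pow_right
  have hGP : G.homogRoots A B ∣ P := hcop.dvd_of_dvd_mul_right ⟨Q, by rw [key', mul_comm]⟩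
  have hPG : P ∣ G.homogRoots A B := hPQ.dvd_of_dvd_mul_left ⟨_, key'.symm⟩
  have hHQ : H.homogRoots A B * B ^ (d + 1) ∣ Q :=
    hcop.symm.dvd_of_dvd_mul_right ⟨P, by rw [← key', mul_comm]⟩
  have hlcG : G.leadingCoeff = P.leadingCoeff := by
    have h := congrArg leadingCoeff key'
    rwa [leadingCoeff_mul_monic (hH'.mul (hB.pow _)), leadingCoeff_mul, hQ.leadingCoeff,
      one_mul, hGhom, eq_comm] at h
  obtain ⟨a, ha, -⟩ := exists_eval_sub_C_mul_eq_zero (x := 0) hG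
    (eval_eq_zero_of_dvd_of_eval_eq_zero hPG hP0)
  have hBmem : B ∈ liftsRing φ := hB.mem_liftsRing_of_dvd hQ.ne_zero
    (((dvd_pow_self B d.succ_ne_zero).mul_left _).trans hHQ) hQroots
  have hGmem : ∀ r ∈ G.roots, A - C r * B ∈ liftsRing φ := fun r hr ↦
    (monic_sub_C_mul hA hdeg r).mem_liftsRing_of_dvd hP
      ((sub_C_mul_dvd_homogRoots hr).trans hGP) hProots
  have hHmem : ∀ r ∈ H.roots, A - C r * B ∈ liftsRing φ := fun r hr ↦
    (monic_sub_C_mul hA hdeg r).mem_liftsRing_of_dvd hQ.ne_zero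
      (((sub_C_mul_dvd_homogRoots hr).mul_right _).trans hHQ) hQroots
  have hsub : ∀ r, A - C r * B ∈ liftsRing φ → r - a ∈ φ.range := fun r hr ↦ by
    refine mem_range_of_C_mul_mem_liftsRing hB ?_
    convert sub_mem (hGmem a ha) hr using 1
    rw [C_sub]
    ring
  refine ⟨a, hGmem a ha, hBmem, ?_, ?_⟩
  · exact comp_X_add_C_mem_liftsRing a (hlcG ▸ hlc) fun r hr ↦ hsub r (hGmem r hr)
  · refine comp_X_add_C_mem_liftsRing a ?_ fun r hr ↦ hsub r (hHmem r hr)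
    rw [hH.leadingCoeff]
    exact one_mem _

end Lifts

end Polynomial

namespace RatFunc

variable {K : Type*} [Field K]

theorem num_div_of_isCoprime {p q : K[X]} (hpq : IsCoprime p q) (hq : q.Monic) :
    (algebraMap K[X] (RatFunc K) p / algebraMap K[X] (RatFunc K) q).num = p := by
  classical
  have hgcd : gcd p q = 1 := by
    rw [← normalize_gcd, normalize_eq_one]
    exact hpq.isUnit_of_dvd' (gcd_dvd_left p q) (gcd_dvd_right p q)
  simp [num_div, hgcd, hq.leadingCoeff]

theorem denom_div_of_isCoprime {p q : K[X]} (hpq : IsCoprime p q) (hq : q.Monic) :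
    (algebraMap K[X] (RatFunc K) p / algebraMap K[X] (RatFunc K) q).denom = q := by
  classical
  have hgcd : gcd p q = 1 := by
    rw [← normalize_gcd, normalize_eq_one]
    exact hpq.isUnit_of_dvd' (gcd_dvd_left p q) (gcd_dvd_right p q)
  simp [denom_div _ hq.ne_zero, hgcd, hq.leadingCoeff]

theorem transcendental_of_one_le_deg {h : RatFunc K} (hh : 1 ≤ h.deg) : Transcendental K h := by
  refine transcendental_of_ne_C h ?_
  rintro ⟨c, rfl⟩
  simp [deg] at hh

/-- Composition with a transcendental `h` on the right, as an algebra homomorphism. -/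
noncomputable def compAlgHom (h : RatFunc K) (hh : Transcendental K h) :
    RatFunc K →ₐ[K] RatFunc K :=
  (IntermediateField.val _).comp (algEquivOfTranscendental h hh).toAlgHom

variable {g h k : RatFunc K}

theorem comp_eq_compAlgHom (hh : Transcendental K h) (g : RatFunc K) :
    g.comp h = compAlgHom h hh g := by
  simp [compAlgHom, comp, algEquivOfTranscendental_apply]

@[simp]
theorem compAlgHom_X (hh : Transcendental K h) : compAlgHom h hh X = h := by
  simp [compAlgHom]

@[simp]
theorem compAlgHom_C (hh : Transcendental K h) (c : K) : compAlgHom h hh (C c) = C c := by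
  rw [← algebraMap_eq_C, AlgHom.commutes]

theorem comp_comp (hk : Transcendental K k) (g h : RatFunc K) :
    (g.comp h).comp k = g.comp (h.comp k) := by
  conv_lhs => rw [comp_eq_compAlgHom hk, comp, map_div₀, ← aeval_algHom_apply,
    ← aeval_algHom_apply, ← comp_eq_compAlgHom]
  rfl

theorem deg_eq_one_of_comp_eq_X (hgh : g.comp h = X) : h.deg = 1 := by
  have htop : IntermediateField.adjoin K {h} = ⊤ := by
    rw [eq_top_iff, ← adjoin_X, IntermediateField.adjoin_simple_le_iff, ← hgh]
    exact (IntermediateField.mem_adjoin_simple_iff _ _).2 ⟨g.num, g.denom, rfl⟩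
  rw [deg, ← finrank_eq_max_natDegree, htop, IntermediateField.finrank_top]

theorem transcendental_C_mul_add_C (hh : Transcendental K h) {a : K} (ha : a ≠ 0) (b : K) :
    Transcendental K (C a * h + C b) := by
  intro halg
  refine hh ?_
  have hC (c : K) : IsAlgebraic K (C c) := by
    rw [← algebraMap_eq_C]; exact isAlgebraic_algebraMap c
  have hCa : C a ≠ 0 := by simpa using ha
  have : h = (C a)⁻¹ * (C a * h + C b - C b) := by field_simp; ring
  rw [this]
  exact (hC a).inv.mul (halg.sub (hC b))

theorem transcendental_inv (hh : Transcendental K h) : Transcendental K h⁻¹ := fun halg ↦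
  hh (by simpa using halg.inv)

/-- A nonconstant rational function can be made to map `∞` to `∞` and to have monic numerator
by composing it with a unit on the left. -/
theorem exists_unit_comp_monic (hh : Transcendental K h) :
    ∃ u v : RatFunc K, Transcendental K u ∧ Transcendental K v ∧ u.comp v = X ∧ v.comp u = X ∧
      (u.comp h).num.Monic ∧ (u.comp h).denom.natDegree < (u.comp h).num.natDegree := by
  have hX : Transcendental K (X : RatFunc K) := transcendental_X
  have hcop := h.isCoprime_num_denom
  have hden := h.monic_denom
  have hden' := algebraMap_ne_zero hden.ne_zero
  have hdiv := h.num_div_denom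
  rcases lt_or_ge h.denom.natDegree h.num.natDegree with hlt | hle
  · have ha : h.num.leadingCoeff ≠ 0 := by
      rw [leadingCoeff_ne_zero]; rintro h0; simp [h0] at hlt
    set a := h.num.leadingCoeff
    have hCa : C a ≠ 0 := by simpa using ha
    have hu := transcendental_C_mul_add_C hX (inv_ne_zero ha) 0
    have hv := transcendental_C_mul_add_C hX ha 0
    have huh : (C a⁻¹ * X + C 0).comp h =
        algebraMap K[X] (RatFunc K) (Polynomial.C a⁻¹ * h.num) /
          algebraMap K[X] (RatFunc K) h.denom := by
      rw [comp_eq_compAlgHom hh]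
      simp [mul_div_assoc, hdiv]
    have hcop' : IsCoprime (Polynomial.C a⁻¹ * h.num) h.denom :=
      (isCoprime_mul_unit_left_left (isUnit_C.2 (inv_ne_zero ha).isUnit) _ _).2 hcop
    refine ⟨_, _, hu, hv, ?_, ?_, ?_, ?_⟩
    · rw [comp_eq_compAlgHom hv]
      simp [hCa]
    · rw [comp_eq_compAlgHom hu]
      simp [hCa]
    · rw [huh, num_div_of_isCoprime hcop' hden]
      exact monic_C_mul_of_mul_leadingCoeff_eq_one (inv_mul_cancel₀ ha)
    · rwa [huh, num_div_of_isCoprime hcop' hden, denom_div_of_isCoprime hcop' hden,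
        natDegree_C_mul (inv_ne_zero ha)]
  · set b := h.num.coeff h.denom.natDegree with hb
    set N := h.num - Polynomial.C b * h.denom with hN
    have hN0 : N ≠ 0 := fun h0 ↦ by
      rw [hN, sub_eq_zero] at h0
      refine hh ?_
      rw [← hdiv, h0, map_mul, mul_div_cancel_right₀ _ hden', algebraMap_C, ← algebraMap_eq_C]
      exact isAlgebraic_algebraMap b
    have hNle : N.natDegree ≤ h.denom.natDegree :=
      (natDegree_sub_le _ _).trans (max_le hle (natDegree_C_mul_le _ _))
    have hNcoeff : N.coeff h.denom.natDegree = 0 := by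
      simp [hN, hden.coeff_natDegree, ← hb]
    have hNlt : N.natDegree < h.denom.natDegree := by
      refine lt_of_le_of_ne hNle fun heq ↦ hN0 ?_
      rwa [← heq, coeff_natDegree, leadingCoeff_eq_zero] at hNcoeff
    have ha : N.leadingCoeff ≠ 0 := leadingCoeff_ne_zero.2 hN0
    set a := N.leadingCoeff
    have hCa : C a ≠ 0 := by simpa using ha
    have hsub := transcendental_C_mul_add_C hX (inv_ne_zero ha) (-(a⁻¹ * b))
    have hu := transcendental_inv hsub
    have hv := transcendental_C_mul_add_C (transcendental_inv hX) ha b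
    have hmon : (Polynomial.C a⁻¹ * N).Monic :=
      monic_C_mul_of_mul_leadingCoeff_eq_one (inv_mul_cancel₀ ha)
    have huh : (C a⁻¹ * X + C (-(a⁻¹ * b)))⁻¹.comp h =
        algebraMap K[X] (RatFunc K) h.denom /
          algebraMap K[X] (RatFunc K) (Polynomial.C a⁻¹ * N) := by
      rw [comp_eq_compAlgHom hh, eq_comm, ← inv_inj, inv_div, map_inv₀ (compAlgHom h hh), inv_inv]
      simp only [hN, map_mul, map_sub, map_add, map_neg, compAlgHom_X, compAlgHom_C,
        algebraMap_C]
      conv_rhs => rw [← hdiv]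
      field_simp
      ring
    have hcop' : IsCoprime h.denom (Polynomial.C a⁻¹ * N) := by
      refine (isCoprime_mul_unit_left_right (isUnit_C.2 (inv_ne_zero ha).isUnit) _ _).2 ?_
      rw [hN, sub_eq_add_neg, ← neg_mul]
      exact (hcop.add_mul_right_left _).symm
    refine ⟨_, _, hu, hv, ?_, ?_, ?_, ?_⟩
    · rw [comp_eq_compAlgHom hv]
      simp only [map_mul, map_inv₀, map_add, map_neg, compAlgHom_X, compAlgHom_C]
      rw [mul_add, inv_mul_cancel_left₀ hCa, add_neg_cancel_right, inv_inv]
    · rw [comp_eq_compAlgHom hu]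
      simp only [map_mul, map_inv₀, map_add, map_neg, compAlgHom_X, compAlgHom_C, inv_inv]
      field_simp
      ring
    · rwa [huh, num_div_of_isCoprime hcop' hmon]
    · rwa [huh, num_div_of_isCoprime hcop' hmon, denom_div_of_isCoprime hcop' hmon,
        natDegree_C_mul (inv_ne_zero ha)]

theorem num_denom_sub_C (h : RatFunc K) (a : K) :
    (h - C a).num = h.num - Polynomial.C a * h.denom ∧ (h - C a).denom = h.denom := by
  have hcop : IsCoprime (h.num - Polynomial.C a * h.denom) h.denom := by
    rw [sub_eq_add_neg, ← neg_mul]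
    exact h.isCoprime_num_denom.add_mul_right_left _
  have heq : h - C a = algebraMap K[X] (RatFunc K) (h.num - Polynomial.C a * h.denom) /
      algebraMap K[X] (RatFunc K) h.denom := by
    rw [map_sub, map_mul, sub_div, num_div_denom,
      mul_div_cancel_right₀ _ (algebraMap_ne_zero h.denom_ne_zero), algebraMap_C]
  constructor
  · conv_lhs => rw [heq, num_div_of_isCoprime hcop h.monic_denom]
  · conv_lhs => rw [heq, denom_div_of_isCoprime hcop h.monic_denom]

theorem num_denom_comp_X_add_C (g : RatFunc K) (a : K) :
    (g.comp (X + C a)).num = g.num.comp (Polynomial.X + Polynomial.C a) ∧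
      (g.comp (X + C a)).denom = g.denom.comp (Polynomial.X + Polynomial.C a) := by
  have hcop : IsCoprime (g.num.comp (Polynomial.X + Polynomial.C a))
      (g.denom.comp (Polynomial.X + Polynomial.C a)) :=
    g.isCoprime_num_denom.map (compRingHom _)
  have hmon := g.monic_denom.comp_X_add_C a
  have hX : (X + C a : RatFunc K) =
      algebraMap K[X] (RatFunc K) (Polynomial.X + Polynomial.C a) := by simp
  have heq : g.comp (X + C a) =
      algebraMap K[X] (RatFunc K) (g.num.comp (Polynomial.X + Polynomial.C a)) /
        algebraMap K[X] (RatFunc K) (g.denom.comp (Polynomial.X + Polynomial.C a)) := by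
    rw [comp, hX, aeval_algebraMap_apply, aeval_algebraMap_apply]
    rfl
  rw [heq]
  exact ⟨num_div_of_isCoprime hcop hmon, denom_div_of_isCoprime hcop hmon⟩

end RatFunc

/-- Over the splitting field `F` of the numerator and denominator of a normal-form
rational function `f ∈ K(x)`, every decomposition of `f` over an algebraic closure `Ω`
is equivalent to a decomposition with all coefficients in `F`. -/
theorem decomposition_coeffs_mem_splittingField
    {K Ω : Type*} [Field K] [Field Ω] [Algebra K Ω] [IsAlgClosure K Ω]
    (f : RatFunc K) (hf1 : 1 ≤ f.deg) (hf : f.IsNormalForm)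
    (F : IntermediateField K Ω)
    (hF : F = IntermediateField.adjoin K (f.num.rootSet Ω ∪ f.denom.rootSet Ω))
    (fΩ : RatFunc Ω)
    (hfΩ : fΩ = algebraMap (Polynomial Ω) (RatFunc Ω) (f.num.map (algebraMap K Ω)) /
        algebraMap (Polynomial Ω) (RatFunc Ω) (f.denom.map (algebraMap K Ω)))
    (g h : RatFunc Ω) (hg : 1 ≤ g.deg) (hh : 1 ≤ h.deg) (hcomp : fΩ = g.comp h) :
    ∃ u v : RatFunc Ω, u.deg = 1 ∧ v.deg = 1 ∧
      u.comp v = RatFunc.X ∧ v.comp u = RatFunc.X ∧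
      (∀ i, (g.comp v).num.coeff i ∈ F) ∧ (∀ i, (g.comp v).denom.coeff i ∈ F) ∧
      (∀ i, (u.comp h).num.coeff i ∈ F) ∧ (∀ i, (u.comp h).denom.coeff i ∈ F) := by
  have hΩ : IsAlgClosed Ω := IsAlgClosure.isAlgClosed K
  have hht := RatFunc.transcendental_of_one_le_deg hh
  have hX : Transcendental Ω (RatFunc.X : RatFunc Ω) := RatFunc.transcendental_X
  obtain ⟨u, v, hu, hv, huv, hvu, hmon, hdeg⟩ := RatFunc.exists_unit_comp_monic hht
  have huh : Transcendental Ω (u.comp h) := by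
    refine RatFunc.transcendental_of_one_le_deg ?_
    rw [RatFunc.deg]
    omega
  have hvuh : v.comp (u.comp h) = h := by
    rw [← RatFunc.comp_comp hht, hvu, RatFunc.comp_eq_compAlgHom hht,
      RatFunc.compAlgHom_X]
  have hgvuh : (g.comp v).comp (u.comp h) = g.comp h := by
    rw [RatFunc.comp_comp huh, hvuh]
  have hroots (p : K[X]) (hp : p.rootSet Ω ⊆ F) (hp0 : p ≠ 0) :
      ∀ r ∈ (p.map (algebraMap K Ω)).roots, r ∈ (algebraMap F Ω).range := fun r hr ↦
    ⟨⟨r, hp (by simpa [mem_rootSet, hp0] using hr)⟩, rfl⟩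
  have hsub : f.num.rootSet Ω ∪ f.denom.rootSet Ω ⊆ F :=
    hF ▸ IntermediateField.subset_adjoin _ _
  have hf0 : f.num ≠ 0 := fun h0 ↦ by simpa [h0] using hf.1
  obtain ⟨a, hA, hB, hG, hH⟩ := exists_translate_mem_liftsRing (φ := algebraMap F Ω)
    (P := f.num.map (algebraMap K Ω)) (Q := f.denom.map (algebraMap K Ω))
    (u.comp h).isCoprime_num_denom (g.comp v).isCoprime_num_denom
    (f.isCoprime_num_denom.map (mapRingHom (algebraMap K Ω))) hmon (u.comp h).monic_denom
    (g.comp v).monic_denom (f.monic_denom.map _) hdeg (by simpa using hf.1)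
    (by rw [← coe_aeval_eq_eval, aeval_map_algebraMap, ← map_zero (algebraMap K Ω),
      aeval_algebraMap_apply, coe_aeval_eq_eval, hf.2])
    (by rw [leadingCoeff_map]; exact ⟨algebraMap K F _, rfl⟩)
    (hroots _ (Set.subset_union_left.trans hsub) hf0)
    (hroots _ (Set.subset_union_right.trans hsub) f.denom_ne_zero)
    (by rw [← hfΩ, hcomp, RatFunc.num_div_denom, ← hgvuh]; rfl)
  have hcoeff {p : Polynomial Ω} (hp : p ∈ liftsRing (algebraMap F Ω)) (i : ℕ) : p.coeff i ∈ F := by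
    obtain ⟨x, hx⟩ := (lifts_iff_coeff_lifts p).1 ((lifts_iff_liftsRing _ p).2 hp) i
    exact hx ▸ x.2
  have hXa : Transcendental Ω (RatFunc.X + RatFunc.C a) := by
    simpa using RatFunc.transcendental_C_mul_add_C hX one_ne_zero a
  have hua : Transcendental Ω (u - RatFunc.C a) := by
    simpa [sub_eq_add_neg] using RatFunc.transcendental_C_mul_add_C hu one_ne_zero (-a)
  have hva : Transcendental Ω (v.comp (RatFunc.X + RatFunc.C a)) := by
    rw [RatFunc.comp_eq_compAlgHom hXa]
    exact mt (isAlgebraic_algHom_iff _ (RatFunc.compAlgHom _ hXa).injective).1 hv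
  have hXaua : (RatFunc.X + RatFunc.C a).comp (u - RatFunc.C a) = u := by
    rw [RatFunc.comp_eq_compAlgHom hua]
    simp
  have huva : (u - RatFunc.C a).comp (v.comp (RatFunc.X + RatFunc.C a)) = RatFunc.X := by
    rw [RatFunc.comp_eq_compAlgHom hva, map_sub, RatFunc.compAlgHom_C,
      ← RatFunc.comp_eq_compAlgHom, ← RatFunc.comp_comp hXa, huv,
      RatFunc.comp_eq_compAlgHom hXa]
    simp
  have hvua : (v.comp (RatFunc.X + RatFunc.C a)).comp (u - RatFunc.C a) = RatFunc.X := by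
    rw [RatFunc.comp_comp hua, hXaua, hvu]
  have hgva : g.comp (v.comp (RatFunc.X + RatFunc.C a)) =
      (g.comp v).comp (RatFunc.X + RatFunc.C a) := (RatFunc.comp_comp hXa g v).symm
  have huha : (u - RatFunc.C a).comp h = u.comp h - RatFunc.C a := by
    rw [RatFunc.comp_eq_compAlgHom hht, map_sub, RatFunc.compAlgHom_C,
      ← RatFunc.comp_eq_compAlgHom]
  refine ⟨u - RatFunc.C a, v.comp (RatFunc.X + RatFunc.C a),
    RatFunc.deg_eq_one_of_comp_eq_X hvua, RatFunc.deg_eq_one_of_comp_eq_X huva, huva, hvua, ?_⟩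
  rw [hgva, huha, (RatFunc.num_denom_comp_X_add_C _ a).1, (RatFunc.num_denom_comp_X_add_C _ a).2,
    (RatFunc.num_denom_sub_C _ a).1, (RatFunc.num_denom_sub_C _ a).2]
  exact ⟨hcoeff hG, hcoeff hH, hcoeff hA, hcoeff hB⟩
end

section
/- Let f ∈ ℚ(x) with deg f = 4, let Ω be an algebraic closure of ℚ, and suppose the image of f in Ω(x) decomposes as f = g∘h with g, h ∈ Ω(x) both of degree 2. Then there exist an intermediate field K of Ω/ℚ with [K:ℚ] ≤ 3 and a unit u ∈ Ω(x) (with compositional inverse u⁻¹) such that all coefficients of the numerators and denominators of g∘u⁻¹ and of u∘h lie in K. -/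
open Polynomial

namespace RatFunc

section Composition

variable {K : Type*} [Field K]

theorem X_comp (h : RatFunc K) : (X : RatFunc K).comp h = h := by
  simp [RatFunc.comp]

theorem algHom_comp (φ : RatFunc K →ₐ[K] RatFunc K) (g h : RatFunc K) :
    φ (g.comp h) = g.comp (φ h) := by
  simp [RatFunc.comp, Polynomial.aeval_algHom_apply]

theorem exists_algHom_eq_comp {h : RatFunc K} (hh : ¬∃ c, h = C c) :
    ∃ φ : RatFunc K →ₐ[K] RatFunc K, ∀ g, φ g = g.comp h := by
  have hinj := transcendental_iff_injective.mp (transcendental_of_ne_C h hh)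
  exact ⟨liftAlgHom (aeval h) (nonZeroDivisors_le_comap_nonZeroDivisors_of_injective _ hinj),
    fun g => liftAlgHom_apply _ _ g⟩

theorem algHom_C (φ : RatFunc K →ₐ[K] RatFunc K) (c : K) : φ (C c) = C c := by
  rw [← algebraMap_eq_C]
  exact φ.commutes c

theorem deg_C (c : K) : (C c).deg = 0 := by
  simp [deg]

theorem ne_C_of_deg_ne_zero {f : RatFunc K} (hf : f.deg ≠ 0) : ¬∃ c, f = C c := by
  rintro ⟨c, rfl⟩
  exact hf (deg_C c)

theorem exists_eq_C_of_deg_eq_zero {f : RatFunc K} (hf : f.deg = 0) : ∃ c, f = C c := by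
  simp only [deg, Nat.max_eq_zero_iff] at hf
  refine ⟨f.num.coeff 0 / f.denom.coeff 0, ?_⟩
  conv_lhs => rw [← num_div_denom f, Polynomial.eq_C_of_natDegree_eq_zero hf.1,
    Polynomial.eq_C_of_natDegree_eq_zero hf.2]
  simp [algebraMap_C]

theorem quadratic_eq_zero {p c₀ c₁ c₂ : K}
    (hc : C c₀ + C c₁ * (X - C p) + C c₂ * (X - C p) ^ 2 = 0) : c₀ = 0 ∧ c₁ = 0 ∧ c₂ = 0 := by
  have h : Polynomial.C c₀ + Polynomial.C c₁ * (Polynomial.X - Polynomial.C p) +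
      Polynomial.C c₂ * (Polynomial.X - Polynomial.C p) ^ 2 = 0 := by
    apply algebraMap_injective K
    simpa [algebraMap_C, algebraMap_X] using hc
  have h' := congrArg (fun q => q.comp (Polynomial.X + Polynomial.C p)) h
  simp only [add_comp, mul_comp, sub_comp, pow_comp, C_comp, Polynomial.X_comp,
    add_sub_cancel_right, zero_comp] at h'
  refine ⟨?_, ?_, ?_⟩
  · simpa using congrArg (coeff · 0) h'
  · simpa [coeff_X_pow, coeff_C] using congrArg (coeff · 1) h'
  · simpa [coeff_X, coeff_C] using congrArg (coeff · 2) h'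

theorem linear_ne_zero {p c₀ c₁ : K} (hc : c₀ ≠ 0 ∨ c₁ ≠ 0) :
    C c₀ + C c₁ * (X - C p) ≠ 0 := by
  intro h
  have := quadratic_eq_zero (p := p) (c₀ := c₀) (c₁ := c₁) (c₂ := 0) (by simpa using h)
  tauto

/-- The rational function `(a x + b) / (c x + d)`. -/
noncomputable def mobius (a b c d : K) : RatFunc K :=
  (C a * X + C b) / (C c * X + C d)

theorem mobius_comp {h : RatFunc K} (hh : ¬∃ c, h = C c) (a b c d : K) :
    (mobius a b c d).comp h = (C a * h + C b) / (C c * h + C d) := by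
  obtain ⟨φ, hφ⟩ := exists_algHom_eq_comp hh
  have hX : φ X = h := by rw [hφ, X_comp]
  rw [← hφ, mobius]
  simp only [map_div₀, map_add, map_mul, algHom_C, hX]

theorem mobius_denom_ne_zero {h : RatFunc K} (hh : ¬∃ c, h = C c) {c d : K}
    (hcd : c ≠ 0 ∨ d ≠ 0) : C c * h + C d ≠ 0 := by
  intro h0
  rcases eq_or_ne c 0 with rfl | hc
  · simp_all
  · refine hh ⟨-d / c, ?_⟩
    have : C c ≠ 0 := by simpa using hc
    rw [map_div₀, eq_div_iff this, map_neg]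
    linear_combination h0

theorem X_ne_C : ¬∃ c : K, X = C c := by
  rintro ⟨c, hc⟩
  have := quadratic_eq_zero (p := 0) (c₀ := -c) (c₁ := 1) (c₂ := 0) (by simp [hc])
  simp at this

theorem mobius_ne_C {a b c d : K} (hdet : a * d - b * c ≠ 0) : ¬∃ e, mobius a b c d = C e := by
  rintro ⟨e, he⟩
  have hcd : c ≠ 0 ∨ d ≠ 0 := by
    by_contra! h
    simp [h] at hdet
  rw [mobius, div_eq_iff (mobius_denom_ne_zero X_ne_C hcd)] at he
  have := quadratic_eq_zero (p := 0) (c₀ := b - e * d) (c₁ := a - e * c) (c₂ := 0)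
    (by simp only [map_sub, map_mul, map_zero]; linear_combination he)
  apply hdet
  linear_combination d * this.2.1 - c * this.1

theorem deg_mobius {a b c d : K} (hdet : a * d - b * c ≠ 0) : (mobius a b c d).deg = 1 := by
  have hq : Polynomial.C c * Polynomial.X + Polynomial.C d ≠ 0 := by
    intro h
    have h₁ := congrArg (coeff · 1) h
    have h₀ := congrArg (coeff · 0) h
    simp [coeff_C] at h₀ h₁
    simp [h₀, h₁] at hdet
  have hp : Polynomial.C a * Polynomial.X + Polynomial.C b ≠ 0 := by
    intro h
    have h₁ := congrArg (coeff · 1) h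
    have h₀ := congrArg (coeff · 0) h
    simp [coeff_C] at h₀ h₁
    simp [h₀, h₁] at hdet
  have heq : mobius a b c d =
      algebraMap K[X] _ (Polynomial.C a * Polynomial.X + Polynomial.C b) /
        algebraMap K[X] _ (Polynomial.C c * Polynomial.X + Polynomial.C d) := by
    simp [mobius, algebraMap_C, algebraMap_X]
  refine le_antisymm (max_le ?_ ?_) (Nat.one_le_iff_ne_zero.mpr ?_)
  · rw [heq]
    exact (natDegree_le_of_dvd (num_div_dvd _ hq) hp).trans natDegree_linear_le
  · rw [heq]
    exact (natDegree_le_of_dvd (denom_div_dvd _ _) hq).trans natDegree_linear_le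
  · exact fun h0 => mobius_ne_C hdet (exists_eq_C_of_deg_eq_zero h0)

theorem mobius_comp_inverse {a b c d : K} (hdet : a * d - b * c ≠ 0) :
    (mobius a b c d).comp (mobius d (-b) (-c) a) = X := by
  have hdet' : d * a - (-b) * (-c) ≠ 0 := by convert hdet using 1; ring
  rw [mobius_comp (mobius_ne_C hdet')]
  have h₁ : C (-c) * X + C a ≠ 0 := mobius_denom_ne_zero X_ne_C (by
    by_contra! h
    simp [h.2, neg_eq_zero.mp h.1] at hdet)
  have hC : C (a * d - b * c) ≠ 0 := (_root_.map_ne_zero C).mpr hdet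
  rw [mobius]
  have h₂ : C c * ((C d * X + C (-b)) / (C (-c) * X + C a)) + C d =
      C (a * d - b * c) / (C (-c) * X + C a) := by
    rw [eq_div_iff h₁, add_mul, mul_assoc, div_mul_cancel₀ _ h₁]
    simp only [map_neg, map_sub, map_mul]
    ring
  have h₃ : C a * ((C d * X + C (-b)) / (C (-c) * X + C a)) + C b =
      C (a * d - b * c) * X / (C (-c) * X + C a) := by
    rw [eq_div_iff h₁, add_mul, mul_assoc, div_mul_cancel₀ _ h₁]
    simp only [map_neg, map_sub, map_mul]
    ring
  rw [h₂, h₃, div_div_div_cancel_right₀ h₁, mul_div_cancel_left₀ _ hC]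

/-- The normal form at the base point `p` of a rational function of degree two. -/
noncomputable def quadraticNormalForm (p a b : K) : RatFunc K :=
  ((X - C p) ^ 2 + C a * (X - C p)) / (1 + C b * (X - C p))

/-- The nontrivial Möbius transformation fixing `quadraticNormalForm p a b`. -/
noncomputable def deckInvolution (p a b : K) : RatFunc K :=
  C p - (C a + (X - C p)) / (1 + C b * (X - C p))

theorem one_add_linear_ne_zero (p b : K) : 1 + C b * (X - C p) ≠ 0 := by
  simpa using linear_ne_zero (p := p) (c₀ := 1) (c₁ := b) (by simp)

theorem deckInvolution_ne_C {p a b : K} (hab : 1 - a * b ≠ 0) :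
    ¬∃ c, deckInvolution p a b = C c := by
  rintro ⟨c, hc⟩
  rw [deckInvolution, sub_eq_iff_eq_add, ← sub_eq_iff_eq_add',
    eq_div_iff (one_add_linear_ne_zero p b)] at hc
  have := quadratic_eq_zero (p := p) (c₀ := a + (c - p)) (c₁ := 1 + (c - p) * b) (c₂ := 0) (by
    simp only [map_add, map_sub, map_mul, map_one, map_zero]
    linear_combination -hc)
  apply hab
  linear_combination this.2.1 - b * this.1

theorem deckInvolution_ne_X [NeZero (2 : K)] (p a b : K) : deckInvolution p a b ≠ X := by
  intro h
  rw [deckInvolution, sub_eq_iff_eq_add, ← sub_eq_iff_eq_add',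
    eq_div_iff (one_add_linear_ne_zero p b)] at h
  have := quadratic_eq_zero (p := p) (c₀ := a) (c₁ := 2) (c₂ := b) (by
    simp only [map_ofNat]
    linear_combination -h)
  exact two_ne_zero this.2.1

theorem deckInvolution_injective {p a b a' b' : K}
    (h : deckInvolution p a b = deckInvolution p a' b') : a = a' ∧ b = b' := by
  rw [deckInvolution, deckInvolution, sub_right_inj,
    div_eq_div_iff (one_add_linear_ne_zero p b) (one_add_linear_ne_zero p b')] at h
  have := quadratic_eq_zero (p := p) (c₀ := a - a') (c₁ := a * b' - a' * b) (c₂ := b' - b) (by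
    simp only [map_sub, map_mul]
    linear_combination h)
  exact ⟨sub_eq_zero.mp this.1, (sub_eq_zero.mp this.2.2).symm⟩

theorem algHom_quadraticNormalForm {p a b : K} (hab : 1 - a * b ≠ 0)
    (φ : RatFunc K →ₐ[K] RatFunc K) (hφ : φ X = deckInvolution p a b) :
    φ (quadraticNormalForm p a b) = quadraticNormalForm p a b := by
  have hq := one_add_linear_ne_zero p b
  have hab' : 1 - C a * C b ≠ 0 := by
    simpa only [map_sub, map_mul, map_one] using (_root_.map_ne_zero C).mpr hab
  have hT : φ X - C p = -(C a + (X - C p)) / (1 + C b * (X - C p)) := by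
    rw [hφ, deckInvolution]
    ring
  simp only [quadraticNormalForm, map_div₀, map_add, map_pow, map_sub, map_mul, map_one, algHom_C]
  rw [hT]
  generalize X - C p = T at hq ⊢
  have h₁ : (-(C a + T) / (1 + C b * T)) ^ 2 + C a * (-(C a + T) / (1 + C b * T)) =
      (1 - C a * C b) * (T ^ 2 + C a * T) / (1 + C b * T) ^ 2 := by
    field_simp
    ring
  have h₂ : 1 + C b * (-(C a + T) / (1 + C b * T)) = (1 - C a * C b) / (1 + C b * T) := by
    field_simp
    ring
  rw [h₁, h₂]
  field_simp

theorem exists_eq_quadratic {q : K[X]} (hq : q.natDegree ≤ 2) (p : K) :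
    ∃ c, q = Polynomial.C (q.eval p) + Polynomial.C c * (Polynomial.X - Polynomial.C p) +
      Polynomial.C (q.coeff 2) * (Polynomial.X - Polynomial.C p) ^ 2 := by
  obtain ⟨c₂, c₁, c₀, rfl⟩ : ∃ c₂ c₁ c₀, q = Polynomial.C c₂ * Polynomial.X ^ 2 +
      Polynomial.C c₁ * Polynomial.X + Polynomial.C c₀ :=
    ⟨_, _, _, eq_quadratic_of_degree_le_two (natDegree_le_iff_degree_le.mp hq)⟩
  refine ⟨c₁ + (c₂ * p + c₂ * p), ?_⟩
  simp
  ring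

theorem exists_nonvanishing_of_deg_two [CharZero K] {h : RatFunc K} (hh : h.deg = 2) :
    ∃ p : ℚ, h.num.coeff 2 * h.denom.eval (p : K) - h.num.eval (p : K) * h.denom.coeff 2 ≠ 0 := by
  by_contra! hp
  have hzero : Polynomial.C (h.num.coeff 2) * h.denom -
      h.num * Polynomial.C (h.denom.coeff 2) = 0 := by
    refine eq_zero_of_infinite_isRoot _ (Set.Infinite.mono ?_
      (Set.infinite_range_of_injective (Rat.cast_injective (α := K))))
    rintro _ ⟨p, rfl⟩
    simpa [IsRoot] using hp p
  rw [sub_eq_zero] at hzero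
  have hcop := isCoprime_num_denom h
  have hle : h.num.natDegree ≤ 2 ∧ h.denom.natDegree ≤ 2 := max_le_iff.mp hh.le
  have key : ∀ {P Q : K[X]} {c d : K}, IsCoprime P Q → c ≠ 0 →
      Polynomial.C c * Q = P * Polynomial.C d → P.natDegree = 0 := by
    intro P Q c d hPQ hc h0
    have hdvd : P ∣ Polynomial.C c := hPQ.dvd_of_dvd_mul_right ⟨_, h0⟩
    simpa using natDegree_le_of_dvd hdvd (Polynomial.C_ne_zero.mpr hc)
  have hcoeff : ∀ {P : K[X]}, P.coeff 2 ≠ 0 → P.natDegree ≠ 0 := fun hP h0 =>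
    hP (coeff_eq_zero_of_natDegree_lt (by omega))
  by_cases hn : h.num.coeff 2 = 0
  · by_cases hd : h.denom.coeff 2 = 0
    · have h₁ : h.num.natDegree ≠ 2 := fun h2 => by
        rw [← h2, coeff_natDegree, leadingCoeff_eq_zero] at hn
        simp [hn] at h2
      have h₂ : h.denom.natDegree ≠ 2 := fun h2 => by
        rw [← h2, coeff_natDegree, leadingCoeff_eq_zero] at hd
        simp [hd] at h2
      rw [deg] at hh
      omega
    · exact hcoeff hd (key hcop.symm hd (by rw [mul_comm, ← hzero, mul_comm]))
  · exact hcoeff hn (key hcop hn hzero)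

/-- A rational function of degree two can be put in normal form by composing with a unit. -/
theorem exists_mobius_comp_eq_quadraticNormalForm [CharZero K] {h : RatFunc K} (hh : h.deg = 2) :
    ∃ (p : ℚ) (α β γ δ a b : K), α * δ - β * γ ≠ 0 ∧ 1 - a * b ≠ 0 ∧
      (mobius α β γ δ).comp h = quadraticNormalForm (p : K) a b := by
  obtain ⟨p, hp⟩ := exists_nonvanishing_of_deg_two hh
  have hne := ne_C_of_deg_ne_zero (f := h) (by omega)
  have hle : h.num.natDegree ≤ 2 ∧ h.denom.natDegree ≤ 2 := max_le_iff.mp hh.le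
  obtain ⟨p₁, hP⟩ := exists_eq_quadratic hle.1 (p : K)
  obtain ⟨q₁, hQ⟩ := exists_eq_quadratic hle.2 (p : K)
  have hcop := isCoprime_num_denom h
  have hdiv := num_div_denom h
  have hQ0 := h.denom_ne_zero
  generalize h.num = P at *
  generalize h.denom = Q at *
  generalize P.eval (p : K) = p₀ at *
  generalize Q.eval (p : K) = q₀ at *
  generalize P.coeff 2 = p₂ at *
  generalize Q.coeff 2 = q₂ at *
  obtain ⟨D, hD⟩ : ∃ D, D = p₂ * q₀ - p₀ * q₂ := ⟨_, rfl⟩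
  rw [← hD] at hp
  obtain ⟨a, ha⟩ : ∃ a, a = (q₀ * p₁ - p₀ * q₁) / D := ⟨_, rfl⟩
  obtain ⟨b, hb⟩ : ∃ b, b = (p₂ * q₁ - q₂ * p₁) / D := ⟨_, rfl⟩
  rw [eq_div_iff hp] at ha hb
  refine ⟨p, q₀, -p₀, -q₂, p₂, a, b, ?_, ?_, ?_⟩
  · convert hp using 1
    rw [hD]
    ring
  · intro hab
    obtain ⟨r, s, hrs⟩ := hcop
    have hPe := congrArg (Polynomial.eval ((p : K) - a)) hP
    have hQe := congrArg (Polynomial.eval ((p : K) - a)) hQ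
    have hrs := congrArg (Polynomial.eval ((p : K) - a)) hrs
    simp only [Polynomial.eval_add, Polynomial.eval_mul, eval_sub, eval_pow,
      Polynomial.eval_C, Polynomial.eval_X, Polynomial.eval_one, sub_sub_cancel_left] at hPe hQe hrs
    have h₁ : q₀ * P.eval (p - a) - p₀ * Q.eval (p - a) = 0 := by
      rw [hPe, hQe]
      linear_combination a * ha - a ^ 2 * hD
    have h₂ : p₂ * Q.eval (p - a) - q₂ * P.eval (p - a) = 0 := by
      rw [hPe, hQe]
      linear_combination a * hb - hD + D * hab
    have h₃ : P.eval (p - a) = 0 := by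
      refine (mul_eq_zero.mp ?_).resolve_left hp
      linear_combination P.eval ((p : K) - a) * hD + p₂ * h₁ + p₀ * h₂
    have h₄ : Q.eval (p - a) = 0 := by
      refine (mul_eq_zero.mp ?_).resolve_left hp
      linear_combination Q.eval ((p : K) - a) * hD + q₂ * h₁ + q₀ * h₂
    simp [h₃, h₄] at hrs
  · have hDC : C D ≠ 0 := (_root_.map_ne_zero C).mpr hp
    have hQ0' := algebraMap_ne_zero hQ0
    have hPC := congrArg (algebraMap K[X] (RatFunc K)) hP
    have hQC := congrArg (algebraMap K[X] (RatFunc K)) hQ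
    have haC := congrArg C ha
    have hbC := congrArg C hb
    have hDC' := congrArg C hD
    simp only [map_add, map_mul, map_sub, map_pow, algebraMap_C, algebraMap_X] at hPC hQC
    simp only [map_mul, map_sub] at haC hbC hDC'
    rw [mobius_comp hne, ← hdiv, quadraticNormalForm]
    generalize algebraMap K[X] (RatFunc K) P = P' at hPC ⊢
    generalize algebraMap K[X] (RatFunc K) Q = Q' at hQC hQ0' ⊢
    generalize X - C (p : K) = T at hPC hQC ⊢
    have h₁ : C q₀ * (P' / Q') + C (-p₀) = C D * (T ^ 2 + C a * T) / Q' := by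
      rw [eq_div_iff hQ0', add_mul, mul_assoc, div_mul_cancel₀ _ hQ0', hPC, hQC, map_neg]
      linear_combination -T * haC - T ^ 2 * hDC'
    have h₂ : C (-q₂) * (P' / Q') + C p₂ = C D * (1 + C b * T) / Q' := by
      rw [eq_div_iff hQ0', add_mul, mul_assoc, div_mul_cancel₀ _ hQ0', hPC, hQC, map_neg]
      linear_combination -T * hbC - hDC'
    rw [h₁, h₂, div_div_div_cancel_right₀ hQ0', mul_div_mul_left _ _ hDC]

theorem exists_algHom_fixing_quadraticNormalForm {p a b : K} (hab : 1 - a * b ≠ 0) :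
    ∃ φ : RatFunc K →ₐ[K] RatFunc K, φ X = deckInvolution p a b ∧
      φ (quadraticNormalForm p a b) = quadraticNormalForm p a b := by
  obtain ⟨φ, hφ⟩ := exists_algHom_eq_comp (deckInvolution_ne_C (p := p) hab)
  have hX : φ X = deckInvolution p a b := by rw [hφ, X_comp]
  exact ⟨φ, hX, algHom_quadraticNormalForm hab φ hX⟩

/-- The endomorphism `τ` of `K(x)` applies `σ` to the coefficients of rational functions. -/
def IsCoefficientMap (σ : K →+* K) (τ : RatFunc K →+* RatFunc K) : Prop :=
  ∀ p q : K[X], τ (algebraMap K[X] _ p / algebraMap K[X] _ q) =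
    algebraMap K[X] _ (p.map σ) / algebraMap K[X] _ (q.map σ)

theorem exists_isCoefficientMap (σ : K →+* K) : ∃ τ, IsCoefficientMap σ τ :=
  have hσ := nonZeroDivisors_le_comap_nonZeroDivisors_of_injective (Polynomial.mapRingHom σ)
    (Polynomial.map_injective σ σ.injective)
  ⟨mapRingHom (Polynomial.mapRingHom σ) hσ, fun p q => map_apply_div _ hσ p q⟩

namespace IsCoefficientMap

variable {σ : K →+* K} {τ : RatFunc K →+* RatFunc K}

theorem map_C (hτ : IsCoefficientMap σ τ) (c : K) : τ (C c) = C (σ c) := by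
  simpa [algebraMap_C] using hτ (Polynomial.C c) 1

theorem map_X (hτ : IsCoefficientMap σ τ) : τ X = X := by
  simpa [algebraMap_X] using hτ Polynomial.X 1

theorem map_comp (hτ : IsCoefficientMap σ τ) (g h : RatFunc K) (hh : ¬∃ c, τ h = C c) :
    τ (g.comp h) = (τ g).comp (τ h) := by
  obtain ⟨φ, hφ⟩ := exists_algHom_eq_comp hh
  have haeval : ∀ p : K[X], τ (aeval h p) = φ (algebraMap K[X] _ (p.map σ)) := by
    intro p
    have hX : φ X = τ h := by rw [hφ, X_comp]
    have hcomp : τ.comp (algebraMap K (RatFunc K)) = (algebraMap K (RatFunc K)).comp σ := by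
      ext c
      simp [algebraMap_eq_C, hτ.map_C]
    rw [← aeval_X_left_eq_algebraMap, ← Polynomial.aeval_algHom_apply φ, hX, aeval_def, hom_eval₂,
      aeval_def, eval₂_map, hcomp]
  rw [← hφ]
  conv_rhs => rw [← num_div_denom g, hτ]
  rw [map_div₀, ← haeval, ← haeval, ← map_div₀, RatFunc.comp]

theorem map_num_denom_eq (hτ : IsCoefficientMap σ τ) {g : RatFunc K} (hg : τ g = g) :
    g.num.map σ = g.num ∧ g.denom.map σ = g.denom := by
  have hD : g.denom.map σ ≠ 0 := (Polynomial.map_ne_zero_iff σ.injective).mpr g.denom_ne_zero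
  have h : g.num.map σ * g.denom = g.num * g.denom.map σ := by
    apply algebraMap_injective K
    rw [map_mul, map_mul, ← div_eq_div_iff (algebraMap_ne_zero hD)
      (algebraMap_ne_zero g.denom_ne_zero), ← hτ, num_div_denom, hg]
  have hdvd : g.denom ∣ g.denom.map σ :=
    (isCoprime_num_denom g).symm.dvd_of_dvd_mul_left ⟨_, by rw [← h, mul_comm]⟩
  have hden : g.denom.map σ = g.denom :=
    eq_of_monic_of_dvd_of_natDegree_le (monic_denom g) ((monic_denom g).map σ) hdvd
      natDegree_map_le
  rw [hden] at h
  exact ⟨mul_right_cancel₀ g.denom_ne_zero h, hden⟩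

theorem map_deckInvolution (hτ : IsCoefficientMap σ τ) (p : ℚ) (a b : K) :
    τ (deckInvolution (p : K) a b) = deckInvolution (p : K) (σ a) (σ b) := by
  simp [deckInvolution, hτ.map_C, hτ.map_X]

theorem map_quadraticNormalForm (hτ : IsCoefficientMap σ τ) (p : ℚ) (a b : K) :
    τ (quadraticNormalForm (p : K) a b) = quadraticNormalForm (p : K) (σ a) (σ b) := by
  simp [quadraticNormalForm, hτ.map_C, hτ.map_X]

end IsCoefficientMap

end Composition

/-- The points of a fibre of a rational function `A / B` over `F` are roots of a nonzero
polynomial of degree at most the degree of `A / B`. -/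
theorem exists_fibre_polynomial {k E : Type*} [Field k] [Field E] [Algebra k E]
    (f : RatFunc k) (hf : f.deg ≠ 0) (F : E) :
    ∃ Φ : E[X], Φ ≠ 0 ∧ Φ.natDegree ≤ f.deg ∧
      ∀ r : E, aeval r f.num = F * aeval r f.denom → Φ.IsRoot r := by
  refine ⟨f.num.map (algebraMap k E) - Polynomial.C F * f.denom.map (algebraMap k E), ?_, ?_, ?_⟩
  · intro h0
    have hc : ∀ i, algebraMap k E (f.num.coeff i) = F * algebraMap k E (f.denom.coeff i) := by
      intro i
      simpa [sub_eq_zero] using congrArg (coeff · i) h0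
    obtain ⟨q, hq⟩ : ∃ q, F = algebraMap k E q := by
      refine ⟨f.num.coeff f.denom.natDegree, ?_⟩
      rw [hc, coeff_natDegree, monic_denom, map_one, mul_one]
    have hnum : f.num = Polynomial.C q * f.denom := by
      ext i
      apply (algebraMap k E).injective
      rw [hc, hq, coeff_C_mul, map_mul]
    apply hf
    have : f = C q := by
      conv_lhs => rw [← num_div_denom f, hnum]
      rw [map_mul, algebraMap_C, mul_div_cancel_right₀ _ (algebraMap_ne_zero f.denom_ne_zero)]
    rw [this, deg_C]
  · refine (natDegree_sub_le _ _).trans (max_le_max natDegree_map_le ?_)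
    exact (natDegree_C_mul_le _ _).trans natDegree_map_le
  · intro r hr
    simp [IsRoot, hr, eval_map_algebraMap]

end RatFunc

open RatFunc IntermediateField in
/-- If all `k`-conjugates of `(a, b)` parametrise points of a finite set, then the degree of
`k(a, b)` is bounded by the size of that set. -/
theorem finrank_adjoin_pair_le {k Ω E : Type*} [Field k] [CharZero k] [Field Ω] [Algebra k Ω]
    [IsAlgClosure k Ω] (a b : Ω) (r : Ω → Ω → E)
    (hr : ∀ {a b a' b'}, r a b = r a' b' → a = a' ∧ b = b') (S : Finset E)
    (hS : ∀ σ : Ω →ₐ[k] Ω, r (σ a) (σ b) ∈ S) :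
    FiniteDimensional k (adjoin k {a, b}) ∧ Module.finrank k (adjoin k {a, b}) ≤ S.card := by
  have : IsAlgClosed Ω := IsAlgClosure.isAlgClosed k
  have : Algebra.IsAlgebraic k Ω := IsAlgClosure.isAlgebraic
  have hfin : FiniteDimensional k (adjoin k {a, b}) :=
    finiteDimensional_adjoin fun x _ => Algebra.IsIntegral.isIntegral x
  refine ⟨hfin, ?_⟩
  have ha : a ∈ adjoin k {a, b} := subset_adjoin _ _ (by simp)
  have hb : b ∈ adjoin k {a, b} := subset_adjoin _ _ (by simp)
  rw [← AlgHom.card k (adjoin k {a, b}) Ω, ← Finset.card_univ]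
  refine Finset.card_le_card_of_injOn (fun φ => r (φ ⟨a, ha⟩) (φ ⟨b, hb⟩)) ?_ ?_
  · intro φ _
    have h : ∀ x (hx : x ∈ adjoin k {a, b}), φ.liftNormal Ω x = φ ⟨x, hx⟩ :=
      fun x hx => φ.liftNormal_commutes Ω ⟨x, hx⟩
    simpa [h a ha, h b hb] using hS (φ.liftNormal Ω)
  · intro φ _ ψ _ h
    obtain ⟨h₁, h₂⟩ := hr h
    refine algHom_ext_of_eq_adjoin _ rfl ?_
    rintro x (rfl | rfl)
    · exact h₁
    · exact h₂

open RatFunc in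
/-- A rational function fixed by all automorphisms over `L` has its coefficients in `L`. -/
theorem coeff_mem_of_fixed {k Ω : Type*} [Field k] [Field Ω] [Algebra k Ω] [IsGalois k Ω]
    (L : IntermediateField k Ω) (g : RatFunc Ω)
    (hg : ∀ σ ∈ L.fixingSubgroup, ∀ τ, IsCoefficientMap (σ : Ω →+* Ω) τ → τ g = g) :
    (∀ i, g.num.coeff i ∈ L) ∧ (∀ i, g.denom.coeff i ∈ L) := by
  have hfix : ∀ σ ∈ L.fixingSubgroup,
      g.num.map (σ : Ω →+* Ω) = g.num ∧ g.denom.map (σ : Ω →+* Ω) = g.denom := by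
    intro σ hσ
    obtain ⟨τ, hτ⟩ := exists_isCoefficientMap (σ : Ω →+* Ω)
    exact hτ.map_num_denom_eq (hg σ hσ τ hτ)
  rw [← InfiniteGalois.fixedField_fixingSubgroup L]
  simp only [IntermediateField.mem_fixedField_iff]
  refine ⟨fun i σ hσ => ?_, fun i σ hσ => ?_⟩
  · simpa using congrArg (coeff · i) (hfix σ hσ).1
  · simpa using congrArg (coeff · i) (hfix σ hσ).2

open RatFunc in
/-- Every degree-4 rational function over `ℚ` that decomposes over `\overline{ℚ}` has an
equivalent decomposition with coefficients in an extension of `ℚ` of degree at most 3. -/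
theorem degree_four_decomposition_over_cubic_extension
    {Ω : Type*} [Field Ω] [Algebra ℚ Ω] [IsAlgClosure ℚ Ω]
    (f : RatFunc ℚ) (hf : f.deg = 4)
    (fΩ : RatFunc Ω)
    (hfΩ : fΩ = algebraMap (Polynomial Ω) (RatFunc Ω) (f.num.map (algebraMap ℚ Ω)) /
        algebraMap (Polynomial Ω) (RatFunc Ω) (f.denom.map (algebraMap ℚ Ω)))
    (g h : RatFunc Ω) (hg : g.deg = 2) (hh : h.deg = 2) (hcomp : fΩ = g.comp h) :
    ∃ K : IntermediateField ℚ Ω, FiniteDimensional ℚ K ∧ Module.finrank ℚ K ≤ 3 ∧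
      ∃ u v : RatFunc Ω, u.deg = 1 ∧ v.deg = 1 ∧
        u.comp v = RatFunc.X ∧ v.comp u = RatFunc.X ∧
        (∀ i, (g.comp v).num.coeff i ∈ K) ∧ (∀ i, (g.comp v).denom.coeff i ∈ K) ∧
        (∀ i, (u.comp h).num.coeff i ∈ K) ∧ (∀ i, (u.comp h).denom.coeff i ∈ K) := by
  have : IsAlgClosed Ω := IsAlgClosure.isAlgClosed ℚ
  have : Algebra.IsAlgebraic ℚ Ω := IsAlgClosure.isAlgebraic
  have : CharZero Ω := algebraRat.charZero Ω
  have : IsGalois ℚ Ω := ⟨⟩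
  obtain ⟨p, α, β, γ, δ, a, b, hdet, hab, hnf⟩ := exists_mobius_comp_eq_quadraticNormalForm hh
  set u := mobius α β γ δ
  set v := mobius δ (-β) (-γ) α
  set H := quadraticNormalForm (p : Ω) a b with hH
  have hdet' : δ * α - (-β) * (-γ) ≠ 0 := by
    convert hdet using 1
    ring
  have huv : u.comp v = RatFunc.X := mobius_comp_inverse hdet
  have hvu : v.comp u = RatFunc.X := by
    simpa only [neg_neg] using mobius_comp_inverse hdet'
  have hhC := ne_C_of_deg_ne_zero (f := h) (by omega)
  obtain ⟨φ, hφ⟩ := exists_algHom_eq_comp hhC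
  have hvH : v.comp H = h := by
    rw [← hnf, ← hφ, ← algHom_comp, hvu, hφ, RatFunc.X_comp]
  have hHC : ¬∃ c, H = RatFunc.C c := by
    rintro ⟨c, hc⟩
    refine mobius_ne_C hdet ⟨c, (φ : RatFunc Ω →+* RatFunc Ω).injective ?_⟩
    rw [RingHom.coe_coe, hφ, hnf, hc, algHom_C]
  obtain ⟨ψ, hψ⟩ := exists_algHom_eq_comp hHC
  have hGH : (g.comp v).comp H = fΩ := by
    rw [← hψ, algHom_comp, hψ, hvH, hcomp]
  have hf_mul : aeval (RatFunc.X : RatFunc Ω) f.num =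
      fΩ * aeval (RatFunc.X : RatFunc Ω) f.denom := by
    have haeval : ∀ q : Polynomial ℚ, aeval (RatFunc.X : RatFunc Ω) q =
        algebraMap (Polynomial Ω) (RatFunc Ω) (q.map (algebraMap ℚ Ω)) := by
      intro q
      rw [← aeval_X_left_eq_algebraMap, aeval_map_algebraMap]
    have hden : f.denom.map (algebraMap ℚ Ω) ≠ 0 :=
      (Polynomial.map_ne_zero_iff (algebraMap ℚ Ω).injective).mpr f.denom_ne_zero
    rw [haeval, haeval, hfΩ, div_mul_cancel₀ _ (algebraMap_ne_zero hden)]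
  have haeval : ∀ (θ : RatFunc Ω →+* RatFunc Ω) (q : Polynomial ℚ) (r : RatFunc Ω),
      θ (aeval r q) = aeval (θ r) q := fun θ q r =>
    (aeval_algHom_apply θ.toRatAlgHom r q).symm
  have hτf : ∀ (σ : Ω →+* Ω) (τ : RatFunc Ω →+* RatFunc Ω),
      IsCoefficientMap σ τ → τ fΩ = fΩ := by
    intro σ τ hτ
    rw [hfΩ, hτ, Polynomial.map_map, Polynomial.map_map,
      Subsingleton.elim (σ.comp (algebraMap ℚ Ω)) (algebraMap ℚ Ω)]
  obtain ⟨θ, hθX, hθH⟩ := exists_algHom_fixing_quadraticNormalForm (p := (p : Ω)) hab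
  have hθf : θ fΩ = fΩ := by
    rw [← hGH, algHom_comp, hθH]
  obtain ⟨Φ, hΦ0, hΦdeg, hΦ⟩ := exists_fibre_polynomial f (by omega) fΩ
  have hroot : ∀ θ : RatFunc Ω →+* RatFunc Ω, θ fΩ = fΩ → Φ.IsRoot (θ RatFunc.X) := by
    intro θ hθ
    apply hΦ
    rw [← haeval, ← haeval, hf_mul, map_mul, hθ]
  classical
  have hcard : (Φ.roots.toFinset.erase RatFunc.X).card ≤ 3 := by
    rw [Finset.card_erase_of_mem (by simpa [hΦ0] using hroot (RingHom.id _) rfl)]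
    have := Multiset.toFinset_card_le Φ.roots
    have := Φ.card_roots'
    omega
  obtain ⟨hfin, hrank⟩ := finrank_adjoin_pair_le (k := ℚ) a b (deckInvolution (p : Ω))
    deckInvolution_injective (Φ.roots.toFinset.erase RatFunc.X) (by
      intro σ
      obtain ⟨τ, hτ⟩ := exists_isCoefficientMap (σ : Ω →+* Ω)
      have h₁ := hroot (τ.comp (θ : RatFunc Ω →+* RatFunc Ω)) (by
        rw [RingHom.comp_apply, RingHom.coe_coe, hθf, hτf _ τ hτ])
      rw [RingHom.comp_apply, RingHom.coe_coe, hθX, hτ.map_deckInvolution] at h₁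
      exact Finset.mem_erase.mpr ⟨deckInvolution_ne_X _ _ _, by simpa [hΦ0] using h₁⟩)
  have hτH : ∀ σ ∈ (IntermediateField.adjoin ℚ {a, b}).fixingSubgroup,
      ∀ τ, IsCoefficientMap (σ : Ω →+* Ω) τ → τ H = H := by
    intro σ hσ τ hτ
    rw [IntermediateField.mem_fixingSubgroup_iff] at hσ
    have ha : σ a = a := hσ a (IntermediateField.subset_adjoin _ _ (by simp))
    have hb : σ b = b := hσ b (IntermediateField.subset_adjoin _ _ (by simp))
    rw [hH, hτ.map_quadraticNormalForm, RingHom.coe_coe, ha, hb]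
  have hG := coeff_mem_of_fixed (IntermediateField.adjoin ℚ {a, b}) (g.comp v) (by
    intro σ hσ τ hτ
    apply (ψ : RatFunc Ω →+* RatFunc Ω).injective
    have hH' := hτH σ hσ τ hτ
    have h₁ := hτ.map_comp (g.comp v) H (by rwa [hH'])
    rw [hH', hGH, hτf _ τ hτ] at h₁
    rw [RingHom.coe_coe, hψ, hψ, hGH, ← h₁])
  have hH_mem := coeff_mem_of_fixed (IntermediateField.adjoin ℚ {a, b}) H hτH
  exact ⟨IntermediateField.adjoin ℚ {a, b}, hfin, hrank.trans hcard, u, v, deg_mobius hdet,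
    deg_mobius hdet', huv, hvu, hG.1, hG.2, by simpa only [hnf] using hH_mem.1,
    by simpa only [hnf] using hH_mem.2⟩
end

section
/- Let K be a field and f ∈ K(x) nonconstant. Then the stabilizer G(f) = {σ ∈ Aut_K K(x) : σ(f) = f} is a finite group whose order divides deg f. -/
open Polynomial

/-- The number of automorphisms of a finite extension divides its degree. -/
theorem AlgEquiv.natCard_dvd_finrank (F E : Type*) [Field F] [Field E] [Algebra F E]
    [FiniteDimensional F E] : Nat.card (E ≃ₐ[F] E) ∣ Module.finrank F E := by
  have h := IntermediateField.finrank_fixedField_eq_card (⊤ : Subgroup (E ≃ₐ[F] E))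
  rw [Subgroup.card_top] at h
  rw [← h]
  exact ⟨_, (mul_comm _ _).trans (Module.finrank_mul_finrank F _ E) |>.symm⟩

/-- The fixing group of a nonconstant rational function `f`, i.e. the stabilizer of `f`
in `Aut_K K(x)`, is finite and its order divides `deg f`. -/
theorem fixingGroup_finite_and_card_dvd_deg {K : Type*} [Field K]
    (f : RatFunc K) (hf : 1 ≤ f.deg) :
    Finite (MulAction.stabilizer (RatFunc K ≃ₐ[K] RatFunc K) f) ∧
    Nat.card (MulAction.stabilizer (RatFunc K ≃ₐ[K] RatFunc K) f) ∣ f.deg := by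
  have hfin : Module.finrank (IntermediateField.adjoin K {f}) (RatFunc K) = f.deg :=
    RatFunc.finrank_eq_max_natDegree f
  have : FiniteDimensional (IntermediateField.adjoin K {f}) (RatFunc K) :=
    Module.finite_of_finrank_pos (hfin ▸ hf)
  have hstab : MulAction.stabilizer (RatFunc K ≃ₐ[K] RatFunc K) f =
      (IntermediateField.adjoin K {f}).fixingSubgroup := by
    ext σ
    rw [IntermediateField.mem_fixingSubgroup_iff, MulAction.mem_stabilizer_iff]
    simpa using (IntermediateField.forall_mem_adjoin_smul_eq_self_iff K (S := {f}) σ).symm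
  let e := IntermediateField.fixingSubgroupEquiv (IntermediateField.adjoin K {f})
  rw [hstab]
  refine ⟨Finite.of_equiv _ e.symm.toEquiv, ?_⟩
  rw [Nat.card_congr e.toEquiv, ← hfin]
  exact AlgEquiv.natCard_dvd_finrank _ _
end

section
/- Let K be a field. The fixed field of the full automorphism group Aut_K K(x) equals K (i.e., the only rational functions in K(x) fixed by every K-algebra automorphism of K(x) are the constants, the elements of the image of K → K(x)) if and only if K is infinite. -/
/-- An element algebraic over an intermediate field `F` has finitely many images under the
automorphisms that fix `F` pointwise. -/
theorem IsAlgebraic.finite_setOf_algEquiv_apply {K L : Type*} [Field K] [Field L] [Algebra K L]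
    {F : IntermediateField K L} {x : L} (hx : IsAlgebraic F x) :
    {y | ∃ σ : L ≃ₐ[K] L, (∀ z ∈ F, σ z = z) ∧ σ x = y}.Finite := by
  obtain ⟨p, hp, hpx⟩ := hx
  refine (p.rootSet_finite L).subset ?_
  rintro _ ⟨σ, hσ, rfl⟩
  let τ : L →ₐ[F] L := { (σ : L →+* L) with commutes' := fun z ↦ hσ z z.2 }
  refine Polynomial.mem_rootSet.mpr ⟨hp, ?_⟩
  change Polynomial.aeval (τ x) p = 0
  rw [Polynomial.aeval_algHom_apply, hpx, map_zero]

namespace RatFunc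

variable {K : Type*} [Field K]

/-- An endomorphism of `K(x)` over `K` is determined by the image of `x`. -/
theorem algEquiv_ext_X {σ τ : RatFunc K ≃ₐ[K] RatFunc K} (h : σ X = τ X) : σ = τ := by
  have key (ρ : RatFunc K ≃ₐ[K] RatFunc K) (p : Polynomial K) :
      ρ (algebraMap (Polynomial K) (RatFunc K) p) = Polynomial.aeval (ρ X) p := by
    rw [← aeval_X_left_eq_algebraMap, Polynomial.aeval_algHom_apply]
  ext f
  rw [← num_div_denom f, map_div₀, map_div₀, key, key, key, key, h]

theorem exists_algEquiv_X_eq_X_add_C (a : K) :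
    ∃ σ : RatFunc K ≃ₐ[K] RatFunc K, σ X = X + C a := by
  refine ⟨IsFractionRing.algEquivOfAlgEquiv (Polynomial.algEquivAevalXAddC a), ?_⟩
  rw [← algebraMap_X, IsFractionRing.algEquivOfAlgEquiv_algebraMap]
  simp

theorem adjoin_algEquiv_X (σ : RatFunc K ≃ₐ[K] RatFunc K) :
    IntermediateField.adjoin K {σ X} = ⊤ := by
  have h := IntermediateField.adjoin_map K {(X : RatFunc K)} (σ : RatFunc K →ₐ[K] RatFunc K)
  rw [adjoin_X, Set.image_singleton, ← AlgHom.fieldRange_eq_map] at h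
  exact h.symm.trans (AlgHom.fieldRange_eq_top.mpr σ.surjective)

/-- Automorphisms of `K(x)` over `K` send `x` to a rational function of degree one. -/
theorem max_natDegree_algEquiv_X (σ : RatFunc K ≃ₐ[K] RatFunc K) :
    max (σ X).num.natDegree (σ X).denom.natDegree = 1 := by
  rw [← finrank_eq_max_natDegree, adjoin_algEquiv_X, IntermediateField.finrank_top]

theorem finite_algEquiv [Finite K] : Finite (RatFunc K ≃ₐ[K] RatFunc K) := by
  refine Finite.of_injective (β := (K × K) × (K × K))
    (fun σ ↦ (((σ X).num.coeff 0, (σ X).num.coeff 1), ((σ X).denom.coeff 0, (σ X).denom.coeff 1)))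
    fun σ τ h ↦ algEquiv_ext_X ?_
  simp only [Prod.mk.injEq] at h
  obtain ⟨⟨h₁, h₂⟩, h₃, h₄⟩ := h
  have hσ := max_le_iff.mp (max_natDegree_algEquiv_X σ).le
  have hτ := max_le_iff.mp (max_natDegree_algEquiv_X τ).le
  have eq_of_coeff {p q : Polynomial K} (hp : p.natDegree ≤ 1) (hq : q.natDegree ≤ 1)
      (h0 : p.coeff 0 = q.coeff 0) (h1 : p.coeff 1 = q.coeff 1) : p = q := by
    rw [Polynomial.eq_X_add_C_of_natDegree_le_one hp, Polynomial.eq_X_add_C_of_natDegree_le_one hq,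
      h0, h1]
  rw [← num_div_denom (σ X), ← num_div_denom (τ X), eq_of_coeff hσ.1 hτ.1 h₁ h₂,
    eq_of_coeff hσ.2 hτ.2 h₃ h₄]

end RatFunc

/-- The fixed field of the full automorphism group `Aut_K K(x)` equals `K` if and only if
`K` is infinite. -/
theorem fixedField_top_eq_bot_iff_infinite (K : Type*) [Field K] :
    IntermediateField.fixedField (⊤ : Subgroup (RatFunc K ≃ₐ[K] RatFunc K)) = ⊥ ↔
      Infinite K := by
  constructor
  · refine fun h ↦ not_finite_iff_infinite.mp fun _ ↦ ?_
    have := RatFunc.finite_algEquiv (K := K)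
    have hX : IsAlgebraic (IntermediateField.fixedField
        (⊤ : Subgroup (RatFunc K ≃ₐ[K] RatFunc K))) (RatFunc.X : RatFunc K) :=
      (FixedPoints.isIntegral (⊤ : Subgroup (RatFunc K ≃ₐ[K] RatFunc K)) (RatFunc K)
        RatFunc.X).isAlgebraic
    rw [h] at hX
    exact RatFunc.transcendental_X (Subalgebra.isAlgebraic_of_isAlgebraic_bot hX)
  · intro _
    by_contra h
    refine Set.infinite_of_injective_forall_mem (f := fun a : K ↦ RatFunc.X + RatFunc.C a)
      (fun a b hab ↦ RatFunc.C_injective (add_left_cancel hab)) (fun a ↦ ?_)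
      (RatFunc.IntermediateField.isAlgebraic_X h).finite_setOf_algEquiv_apply
    obtain ⟨σ, hσ⟩ := RatFunc.exists_algEquiv_X_eq_X_add_C a
    exact ⟨σ, fun z hz ↦ (IntermediateField.mem_fixedField_iff _ _).mp hz σ (Subgroup.mem_top σ),
      hσ⟩
end

section
/- Let K be a field and f ∈ K[x] a tame polynomial with deg f ≥ 2. Suppose f = g₁ ∘ g₂ ∘ ⋯ ∘ g_r = h₁ ∘ h₂ ∘ ⋯ ∘ h_s are two complete decompositions of f into indecomposable polynomials (composition taken as Polynomial.comp, associated to the right). Then r = s and the multiset of degrees {deg g₁, …, deg g_r} equals the multiset {deg h₁, …, deg h_s}. -/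
open Polynomial

/-- A polynomial (of degree ≥ 2) is indecomposable if in every functional
decomposition one of the components is linear. -/
def Polynomial.Indecomposable {K : Type*} [Field K] (f : K[X]) : Prop :=
  ∀ g h : K[X], f = g.comp h → g.natDegree = 1 ∨ h.natDegree = 1

namespace Ritt

variable {K : Type*} [Field K]

/-- `s` has no terms of exponent below `N`, and the coefficient of exponent `N` is `c`. -/
def HasLeadingTerm (s : HahnSeries ℤ K) (N : ℤ) (c : K) : Prop :=
  (∀ i < N, s.coeff i = 0) ∧ s.coeff N = c

namespace HasLeadingTerm

variable {s t : HahnSeries ℤ K} {N M : ℤ} {c d : K}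

theorem zero (N : ℤ) : HasLeadingTerm (0 : HahnSeries ℤ K) N 0 := by
  simp [HasLeadingTerm]

theorem one : HasLeadingTerm (1 : HahnSeries ℤ K) 0 1 :=
  ⟨fun i hi => by simp [HahnSeries.coeff_one, hi.ne], by simp [HahnSeries.coeff_one]⟩

theorem add (hs : HasLeadingTerm s N c) (ht : HasLeadingTerm t N d) :
    HasLeadingTerm (s + t) N (c + d) :=
  ⟨fun i hi => by simp [hs.1 i hi, ht.1 i hi], by simp [hs.2, ht.2]⟩

theorem C_mul (a : K) (hs : HasLeadingTerm s N c) :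
    HasLeadingTerm (HahnSeries.C a * s) N (a * c) := by
  rw [HahnSeries.C_mul_eq_smul]
  exact ⟨fun i hi => by simp [hs.1 i hi], by simp [hs.2]⟩

theorem of_lt (hs : HasLeadingTerm s N c) (h : M < N) : HasLeadingTerm s M 0 :=
  ⟨fun i hi => hs.1 i (hi.trans h), hs.1 M h⟩

theorem mul (hs : HasLeadingTerm s N c) (ht : HasLeadingTerm t M d) :
    HasLeadingTerm (s * t) (N + M) (c * d) := by
  have key : ∀ i j : ℤ, i + j ≤ N + M → s.coeff i * t.coeff j ≠ 0 → i = N ∧ j = M := by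
    intro i j hij h
    have h1 : N ≤ i := by
      by_contra! hi
      exact h (by rw [hs.1 i hi, zero_mul])
    have h2 : M ≤ j := by
      by_contra! hj
      exact h (by rw [ht.1 j hj, mul_zero])
    omega
  constructor
  · intro i hi
    rw [HahnSeries.coeff_mul]
    refine Finset.sum_eq_zero fun p hp => ?_
    by_contra h
    rw [Finset.mem_antidiagonal] at hp
    have := key p.1 p.2 (by omega) h
    omega
  · rw [HahnSeries.coeff_mul, Finset.sum_eq_single (N, M), hs.2, ht.2]
    · rintro ⟨i, j⟩ hp hne
      by_contra h
      rw [Finset.mem_antidiagonal] at hp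
      obtain ⟨rfl, rfl⟩ := key i j (by simp at hp; omega) h
      exact hne rfl
    · intro h
      rw [Finset.mem_antidiagonal] at h
      by_contra h'
      exact h ⟨fun h0 => h' (by simp [h0]), fun h0 => h' (by simp [h0]), rfl⟩

theorem pow (hs : HasLeadingTerm s N c) (k : ℕ) : HasLeadingTerm (s ^ k) (k * N) (c ^ k) := by
  induction k with
  | zero => simpa using one
  | succ k ih =>
    rw [pow_succ, pow_succ]
    convert ih.mul hs using 1
    push_cast
    ring

theorem sum {ι : Type*} (I : Finset ι) {S : ι → HahnSeries ℤ K} {C : ι → K}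
    (h : ∀ i ∈ I, HasLeadingTerm (S i) N (C i)) :
    HasLeadingTerm (∑ i ∈ I, S i) N (∑ i ∈ I, C i) := by
  classical
  induction I using Finset.induction_on with
  | empty => simpa using zero N
  | insert a I ha ih =>
    rw [Finset.sum_insert ha, Finset.sum_insert ha]
    exact (h a (Finset.mem_insert_self a I)).add
      (ih fun i hi => h i (Finset.mem_insert_of_mem hi))

theorem eval₂_C (hs : HasLeadingTerm s (-N) c) (hN : 0 < N) (p : K[X]) :
    HasLeadingTerm (p.eval₂ HahnSeries.C s) (-(p.natDegree * N))
      (p.leadingCoeff * c ^ p.natDegree) := by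
  rw [eval₂_eq_sum_range, Finset.sum_range_succ]
  have h0 : HasLeadingTerm (∑ i ∈ Finset.range p.natDegree, HahnSeries.C (p.coeff i) * s ^ i)
      (-(p.natDegree * N)) (∑ i ∈ Finset.range p.natDegree, 0) := by
    refine sum _ fun i hi => ?_
    refine ((hs.pow i).C_mul _).of_lt ?_
    have : (i : ℤ) < p.natDegree := by exact_mod_cast Finset.mem_range.1 hi
    nlinarith
  have h1 := (hs.pow p.natDegree).C_mul (p.coeff p.natDegree)
  rw [mul_neg] at h1
  simpa using h0.add h1

theorem eval₂_C_sub_eval₂_C (hs : HasLeadingTerm s (-N) c) (ht : HasLeadingTerm t (-N) c)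
    (hN : 0 < N) (p : K[X]) :
    ∃ q : HahnSeries ℤ K, p.eval₂ HahnSeries.C s - p.eval₂ HahnSeries.C t = q * (s - t) ∧
      HasLeadingTerm q (-((p.natDegree - 1) * N))
        (p.leadingCoeff * (p.natDegree * c ^ (p.natDegree - 1))) := by
  refine ⟨∑ i ∈ Finset.range (p.natDegree + 1), HahnSeries.C (p.coeff i) *
    ∑ j ∈ Finset.range i, s ^ j * t ^ (i - 1 - j), ?_, ?_⟩
  · rw [eval₂_eq_sum_range, eval₂_eq_sum_range, ← Finset.sum_sub_distrib, Finset.sum_mul]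
    refine Finset.sum_congr rfl fun i _ => ?_
    rw [mul_assoc, geom_sum₂_mul, mul_sub]
  · have hterm (i : ℕ) : HasLeadingTerm (∑ j ∈ Finset.range i, s ^ j * t ^ (i - 1 - j))
        (-((i - 1) * N)) (i * c ^ (i - 1)) := by
      have : (i : K) * c ^ (i - 1) = ∑ j ∈ Finset.range i, c ^ (i - 1) := by simp
      rw [this]
      refine sum _ fun j hj => ?_
      have hj := Finset.mem_range.1 hj
      convert (hs.pow j).mul (ht.pow (i - 1 - j)) using 1
      · have : ((i - 1 - j : ℕ) : ℤ) = i - 1 - j := by omega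
        rw [this]
        ring
      · rw [← pow_add]
        congr 1
        omega
    rw [Finset.sum_range_succ]
    have h0 : HasLeadingTerm (∑ i ∈ Finset.range p.natDegree, HahnSeries.C (p.coeff i) *
        ∑ j ∈ Finset.range i, s ^ j * t ^ (i - 1 - j))
        (-((p.natDegree - 1) * N)) (∑ i ∈ Finset.range p.natDegree, 0) := by
      refine sum _ fun i hi => ?_
      refine ((hterm i).C_mul _).of_lt ?_
      have : (i : ℤ) < p.natDegree := by exact_mod_cast Finset.mem_range.1 hi
      nlinarith
    have h1 := h0.add ((hterm p.natDegree).C_mul (p.coeff p.natDegree))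
    rw [Finset.sum_const_zero, zero_add] at h1
    exact h1

end HasLeadingTerm

variable (K) in
/-- The series all of whose exponents are divisible by `m`. -/
def dvdExponents (m : ℕ) : Subring (HahnSeries ℤ K) where
  carrier := {s | ∀ i, s.coeff i ≠ 0 → (m : ℤ) ∣ i}
  mul_mem' := by
    intro s t hs ht i hi
    rw [HahnSeries.coeff_mul] at hi
    obtain ⟨p, hp, hne⟩ := Finset.exists_ne_zero_of_sum_ne_zero hi
    rw [Finset.mem_antidiagonal] at hp
    rw [← hp.2.2]
    exact dvd_add (hs _ (left_ne_zero_of_mul hne)) (ht _ (right_ne_zero_of_mul hne))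
  add_mem' := by
    intro s t hs ht i hi
    by_cases h : s.coeff i = 0
    · exact ht i fun h' => hi (by simp [h, h'])
    · exact hs i h
  zero_mem' := by simp
  one_mem' := by
    intro i hi
    by_cases h : i = 0
    · simp [h]
    · simp [HahnSeries.coeff_one, h] at hi
  neg_mem' := by
    intro s hs i hi
    exact hs i (by simpa using hi)

theorem C_mem_dvdExponents (m : ℕ) (r : K) : HahnSeries.C r ∈ dvdExponents K m := by
  intro i hi
  by_cases h : i = 0
  · simp [h]
  · exact absurd (by rw [HahnSeries.C_apply, HahnSeries.coeff_single_of_ne h]) hi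

theorem eval₂_C_mem_dvdExponents {m : ℕ} {s : HahnSeries ℤ K} (hs : s ∈ dvdExponents K m)
    (p : K[X]) : p.eval₂ HahnSeries.C s ∈ dvdExponents K m := by
  rw [eval₂_eq_sum_range]
  exact sum_mem fun i _ => mul_mem (C_mem_dvdExponents m _) (pow_mem hs i)

theorem dvdExponents_anti {m k : ℕ} (h : k ∣ m) : dvdExponents K m ≤ dvdExponents K k :=
  fun _ hs i hi => (Int.natCast_dvd_natCast.2 h).trans (hs i hi)

/-- A root `s` of a tame polynomial equation with right-hand side in `K((t ^ m))`, whose leading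
exponent is `-m`, lies in `K((t ^ m))`. -/
theorem mem_dvdExponents_of_eval₂_C_mem {s : HahnSeries ℤ K} {m : ℕ} {c : K} (hm : 0 < m)
    (hs : HasLeadingTerm s (-m) c) (hc : c ≠ 0) {p : K[X]} (hp : (p.natDegree : K) ≠ 0)
    (h : p.eval₂ HahnSeries.C s ∈ dvdExponents K m) : s ∈ dvdExponents K m := by
  classical
  let t : HahnSeries ℤ K :=
    ⟨fun i => if (m : ℤ) ∣ i then s.coeff i else 0, s.isPWO_support.mono fun i hi => by
      by_contra h0
      simp_all⟩
  have htc (i : ℤ) : t.coeff i = if (m : ℤ) ∣ i then s.coeff i else 0 := rfl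
  have ht : t ∈ dvdExponents K m := fun i hi => by
    by_contra h0
    exact hi (by rw [htc, if_neg h0])
  have htl : HasLeadingTerm t (-m) c := by
    refine ⟨fun i hi => ?_, ?_⟩
    · rw [htc, hs.1 i hi, ite_self]
    · rw [htc, if_pos (by simp), hs.2]
  obtain ⟨q, hq, hql⟩ := hs.eval₂_C_sub_eval₂_C htl (by exact_mod_cast hm) p
  by_cases hst : s - t = 0
  · rwa [sub_eq_zero.1 hst]
  exfalso
  have hp0 : p.leadingCoeff ≠ 0 := by
    rw [leadingCoeff_ne_zero]
    rintro rfl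
    simp at hp
  have he := HahnSeries.coeff_order_eq_zero.not.2 hst
  have hmul := hql.mul (t := s - t) (M := (s - t).order) ⟨fun i hi =>
    HahnSeries.coeff_eq_zero_of_lt_order hi, rfl⟩
  have hmem : p.eval₂ HahnSeries.C s - p.eval₂ HahnSeries.C t ∈ dvdExponents K m :=
    sub_mem h (eval₂_C_mem_dvdExponents ht p)
  rw [hq] at hmem
  have hdvd := hmem _ (by
    rw [hmul.2]
    exact mul_ne_zero (mul_ne_zero hp0 (mul_ne_zero hp (pow_ne_zero _ hc))) he)
  have hdvd' : (m : ℤ) ∣ (s - t).order := by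
    refine (dvd_add_right ?_).1 hdvd
    exact (dvd_mul_left _ _).neg_right
  refine he ?_
  rw [HahnSeries.coeff_sub, htc, if_pos hdvd', sub_self]

/-- Hensel's lemma at infinity: a monic tame polynomial `f` of degree `n` takes the value `t ^ (-n)`
at a Laurent series in `t` with leading term `t⁻¹`. -/
theorem exists_eval₂_C_eq_single_of_monic {f : K[X]} (hf : f.Monic) (hn : (f.natDegree : K) ≠ 0) :
    ∃ x : HahnSeries ℤ K, HasLeadingTerm x (-1) 1 ∧
      f.eval₂ HahnSeries.C x = HahnSeries.single (-(f.natDegree : ℤ)) 1 := by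
  have hn0 : f.natDegree ≠ 0 := fun h => hn (by rw [h, Nat.cast_zero])
  set G : (PowerSeries K)[X] := (f.map PowerSeries.C).scaleRoots PowerSeries.X with hG
  have hfC : (f.map (PowerSeries.C (R := K))).Monic := hf.map _
  have hGm : G.Monic := (monic_scaleRoots_iff _).2 hfC
  have hGn : G.natDegree = f.natDegree := by rw [hG, natDegree_scaleRoots, hf.natDegree_map]
  have hG0 : G.map (PowerSeries.constantCoeff (R := K)) = X ^ f.natDegree := by
    rw [hG, map_scaleRoots _ _ _ (by simp [hfC.leadingCoeff]), PowerSeries.constantCoeff_X,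
      map_map]
    simp [hf.leadingCoeff]
  have hFm : (G - 1).Monic := by
    refine hGm.sub_of_left ?_
    rw [degree_one, ← natDegree_pos_iff_degree_pos, hGn]
    omega
  have hcc (p : (PowerSeries K)[X]) : PowerSeries.constantCoeff (p.eval 1) =
      (p.map PowerSeries.constantCoeff).eval 1 := by
    rw [eval_map, ← eval₂_at_apply, map_one]
  obtain ⟨u, hu, hu1⟩ := HenselianRing.is_henselian
    (I := (Ideal.span {PowerSeries.X} : Ideal (PowerSeries K))) (G - 1) hFm 1
    (by
      rw [Ideal.mem_span_singleton, PowerSeries.X_dvd_iff, hcc]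
      simp [hG0])
    (by
      refine IsUnit.map _ ?_
      rw [PowerSeries.isUnit_iff_constantCoeff, hcc, ← derivative_map]
      simp [hG0, derivative_X_pow, hn])
  rw [Ideal.mem_span_singleton, PowerSeries.X_dvd_iff, map_sub, map_one, sub_eq_zero] at hu1
  have hroot : G.eval u = 1 := by simpa [sub_eq_zero] using hu
  refine ⟨HahnSeries.single (-1) 1 * HahnSeries.ofPowerSeries ℤ K u, ?_, ?_⟩
  · have h1 : HasLeadingTerm (HahnSeries.single (-1 : ℤ) (1 : K)) (-1) 1 :=
      ⟨fun i hi => HahnSeries.coeff_single_of_ne hi.ne, by simp⟩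
    have h2 : HasLeadingTerm (HahnSeries.ofPowerSeries ℤ K u) 0 1 := by
      refine ⟨fun i hi => ?_, ?_⟩
      · rw [PowerSeries.coeff_coe, if_pos hi]
      · rw [PowerSeries.coeff_coe, if_neg (lt_irrefl _)]
        simpa using hu1
    simpa using h1.mul h2
  · have h := congrArg (HahnSeries.ofPowerSeries ℤ K) hroot
    have hs : HahnSeries.single (1 : ℤ) (1 : K) * HahnSeries.single (-1) 1 = 1 := by
      simp [HahnSeries.single_mul_single]
    rw [← eval₂_at_apply, map_one] at h
    have h' := scaleRoots_eval₂_mul (p := f.map (PowerSeries.C (R := K)))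
      (HahnSeries.ofPowerSeries ℤ K)
      (HahnSeries.single (-1) 1 * HahnSeries.ofPowerSeries ℤ K u) PowerSeries.X
    rw [HahnSeries.ofPowerSeries_X, ← mul_assoc, hs, one_mul, ← hG, h, hf.natDegree_map,
      eval₂_map] at h'
    have hC : (HahnSeries.ofPowerSeries ℤ K).comp (PowerSeries.C (R := K)) = HahnSeries.C := by
      ext r : 1
      simp
    rw [hC] at h'
    calc _ = (HahnSeries.single (1 : ℤ) (1 : K) * HahnSeries.single (-1) 1) ^ f.natDegree * _ := by
          rw [hs, one_pow, one_mul]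
      _ = HahnSeries.single (-1 : ℤ) (1 : K) ^ f.natDegree := by
          rw [mul_comm (HahnSeries.single (1 : ℤ) (1 : K)), mul_pow, mul_assoc, ← h', mul_one]
      _ = _ := by simp [HahnSeries.single_pow]

/-- A tame polynomial `f` of degree `n` takes a value in `K((t ^ n))` at a Laurent series with
leading term `t⁻¹`. -/
theorem exists_eval₂_C_mem_dvdExponents {f : K[X]} (hn : (f.natDegree : K) ≠ 0) :
    ∃ x : HahnSeries ℤ K, HasLeadingTerm x (-1) 1 ∧
      f.eval₂ HahnSeries.C x ∈ dvdExponents K f.natDegree := by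
  have hf0 : f.leadingCoeff ≠ 0 := by
    rw [leadingCoeff_ne_zero]
    rintro rfl
    simp at hn
  have hd : (C f.leadingCoeff⁻¹ * f).natDegree = f.natDegree :=
    natDegree_C_mul (inv_ne_zero hf0)
  obtain ⟨x, hx, hfx⟩ := exists_eval₂_C_eq_single_of_monic (f := C f.leadingCoeff⁻¹ * f)
    (by rw [Monic, leadingCoeff_mul, leadingCoeff_C, inv_mul_cancel₀ hf0]) (by rwa [hd])
  refine ⟨x, hx, ?_⟩
  have hf : f = C f.leadingCoeff * (C f.leadingCoeff⁻¹ * f) := by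
    rw [← mul_assoc, ← C_mul, mul_inv_cancel₀ hf0, C_1, one_mul]
  have h : f.eval₂ HahnSeries.C x =
      HahnSeries.C f.leadingCoeff * HahnSeries.single (-(f.natDegree : ℤ)) 1 := by
    conv_lhs => rw [hf, eval₂_mul, eval₂_C, hfx, hd]
  rw [h]
  refine mul_mem (C_mem_dvdExponents _ _) fun i hi => ?_
  by_cases hi' : i = -(f.natDegree : ℤ)
  · exact hi' ▸ (dvd_refl _).neg_right
  · exact absurd (HahnSeries.coeff_single_of_ne hi') hi

theorem HasLeadingTerm.dvd_natDegree {x : HahnSeries ℤ K} (hx : HasLeadingTerm x (-1) 1) {m : ℕ}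
    {p : K[X]} (hp : p.eval₂ HahnSeries.C x ∈ dvdExponents K m) : m ∣ p.natDegree := by
  by_cases hp0 : p = 0
  · simp [hp0]
  have h := (hx.eval₂_C one_pos p).2
  rw [one_pow, mul_one, mul_one] at h
  have h' := hp _ (by rw [h]; exact leadingCoeff_ne_zero.2 hp0)
  exact Int.natCast_dvd_natCast.1 (Int.dvd_neg.1 h')

theorem natDegree_cast_ne_zero_of_comp {a b : K[X]} (h : ((a.comp b).natDegree : K) ≠ 0) :
    (a.natDegree : K) ≠ 0 ∧ (b.natDegree : K) ≠ 0 := by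
  rw [natDegree_comp, Nat.cast_mul] at h
  exact ⟨left_ne_zero_of_mul h, right_ne_zero_of_mul h⟩

theorem pos_of_natCast_ne_zero {n : ℕ} (h : (n : K) ≠ 0) : 0 < n :=
  Nat.pos_of_ne_zero fun h0 => h (by rw [h0, Nat.cast_zero])

/-- At a Laurent series where `a ∘ b` takes a value in `K((t ^ n))`, `n = deg (a ∘ b)`, the
right factor `b` takes a value in `K((t ^ deg b))`. -/
theorem HasLeadingTerm.eval₂_C_mem_of_comp {x : HahnSeries ℤ K} (hx : HasLeadingTerm x (-1) 1)
    {a b : K[X]} (hn : ((a.comp b).natDegree : K) ≠ 0)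
    (h : (a.comp b).eval₂ HahnSeries.C x ∈ dvdExponents K (a.comp b).natDegree) :
    b.eval₂ HahnSeries.C x ∈ dvdExponents K b.natDegree := by
  obtain ⟨ha, hb⟩ := natDegree_cast_ne_zero_of_comp hn
  have hb0 := pos_of_natCast_ne_zero hb
  have hl := hx.eval₂_C one_pos b
  rw [one_pow, mul_one, mul_one] at hl
  refine mem_dvdExponents_of_eval₂_C_mem hb0 hl ?_ ha ?_
  · rw [leadingCoeff_ne_zero]
    rintro rfl
    simp at hb0
  · rw [eval₂_comp] at h
    exact dvdExponents_anti (natDegree_comp (p := a) (q := b) ▸ dvd_mul_left _ _) h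

/-- A subalgebra of `K[X]` all of whose elements have degree divisible by the degree of some
nonconstant element `e` consists of polynomials in `e`. -/
theorem exists_eq_comp_of_dvd_natDegree (A : Subalgebra K K[X]) {e : K[X]} (he : e ∈ A)
    (he0 : 0 < e.natDegree) (hA : ∀ r ∈ A, e.natDegree ∣ r.natDegree) {r : K[X]} (hr : r ∈ A) :
    ∃ t : K[X], r = t.comp e := by
  induction hn : r.natDegree using Nat.strong_induction_on generalizing r with
  | _ n ih =>
  by_cases hr0 : r.natDegree = 0
  · exact ⟨C (r.coeff 0), by rw [C_comp]; exact eq_C_of_natDegree_eq_zero hr0⟩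
  obtain ⟨k, hk⟩ := hA r hr
  have hr' : r ≠ 0 := by
    rintro rfl
    simp at hr0
  have hel : e.leadingCoeff ^ k ≠ 0 := by
    refine pow_ne_zero _ (leadingCoeff_ne_zero.2 ?_)
    rintro rfl
    simp at he0
  set c := r.leadingCoeff / e.leadingCoeff ^ k with hc
  have hc0 : c ≠ 0 := div_ne_zero (leadingCoeff_ne_zero.2 hr') hel
  have hlc : (C c * e ^ k).leadingCoeff = r.leadingCoeff := by
    rw [leadingCoeff_mul, leadingCoeff_C, leadingCoeff_pow, hc, div_mul_cancel₀ _ hel]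
  have hdeg : (C c * e ^ k).natDegree = r.natDegree := by
    rw [natDegree_C_mul hc0, natDegree_pow, hk, mul_comm]
  have hne : C c * e ^ k ≠ 0 := by
    rw [← leadingCoeff_ne_zero, hlc]
    exact leadingCoeff_ne_zero.2 hr'
  have hmem : r - C c * e ^ k ∈ A :=
    sub_mem hr (mul_mem (A.algebraMap_mem c) (pow_mem he k))
  obtain ⟨t, ht⟩ : ∃ t : K[X], r - C c * e ^ k = t.comp e := by
    by_cases h0 : r - C c * e ^ k = 0
    · exact ⟨0, by rw [h0, zero_comp]⟩
    · have hlt := degree_sub_lt_left (p := r) (q := C c * e ^ k)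
        (by rw [degree_eq_natDegree hr', degree_eq_natDegree hne, hdeg]) hr' hlc.symm
      exact ih _ (hn ▸ natDegree_lt_natDegree h0 hlt) hmem rfl
  refine ⟨t + C c * X ^ k, ?_⟩
  rw [add_comp, ← ht, mul_comp, C_comp, pow_comp, X_comp, sub_add_cancel]

/-- Two polynomials `b` and `d`, right components of the same tame polynomial, have a common left
multiple (with respect to composition) of degree `lcm (deg b) (deg d)`. -/
theorem exists_comp_eq_comp_of_eval₂_C_mem {x : HahnSeries ℤ K} (hx : HasLeadingTerm x (-1) 1)
    {b d : K[X]} (hb0 : 0 < b.natDegree) (hd0 : 0 < d.natDegree)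
    (hb : b.eval₂ HahnSeries.C x ∈ dvdExponents K b.natDegree)
    (hd : d.eval₂ HahnSeries.C x ∈ dvdExponents K d.natDegree) :
    ∃ p q : K[X], p.comp b = q.comp d ∧
      (p.comp b).natDegree = Nat.lcm b.natDegree d.natDegree := by
  classical
  set L := Nat.lcm b.natDegree d.natDegree with hL
  obtain ⟨k, hk⟩ := Nat.dvd_lcm_left b.natDegree d.natDegree
  obtain ⟨l, hl⟩ := Nat.dvd_lcm_right b.natDegree d.natDegree
  have hL0 : 0 < L := Nat.lcm_pos hb0 hd0
  rw [← hL] at hk hl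
  have hl0 : 0 < l := by
    rcases Nat.eq_zero_or_pos l with rfl | h
    · simp [hl] at hL0
    · exact h
  let S : Finset ℕ := (Finset.range (k + 1)).image (b.natDegree * ·) ∪
    (Finset.range (l - 1)).image (fun j => d.natDegree * (j + 1))
  have hS : S.card ≤ k + l := by
    refine (Finset.card_union_le _ _).trans ?_
    have h1 := Finset.card_image_le (s := Finset.range (k + 1)) (f := (b.natDegree * ·))
    have h2 := Finset.card_image_le (s := Finset.range (l - 1))
      (f := fun j => d.natDegree * (j + 1))
    rw [Finset.card_range] at h1 h2
    omega
  let toPoly (n : ℕ) : (Fin n → K) →ₗ[K] K[X] :=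
    (degreeLT K n).subtype ∘ₗ (degreeLTEquiv K n).symm.toLinearMap
  have toPoly_inj (n : ℕ) : Function.Injective (toPoly n) :=
    Subtype.val_injective.comp (degreeLTEquiv K n).symm.injective
  have toPoly_deg (n : ℕ) (u : Fin n → K) : (toPoly n u).degree < n :=
    mem_degreeLT.1 ((degreeLTEquiv K n).symm u).2
  let T : ((Fin (k + 1) → K) × (Fin l → K)) →ₗ[K] (S → K) :=
    LinearMap.pi fun i : S => lcoeff K (i : ℕ) ∘ₗ
      ((aeval b).toLinearMap ∘ₗ toPoly (k + 1) ∘ₗ LinearMap.fst K _ _ -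
        (aeval d).toLinearMap ∘ₗ LinearMap.mulLeft K X ∘ₗ toPoly l ∘ₗ LinearMap.snd K _ _)
  have hker : LinearMap.ker T ≠ ⊥ := by
    refine LinearMap.ker_ne_bot_of_finrank_lt ?_
    simp
    omega
  obtain ⟨⟨u, v⟩, huv, huv0⟩ := (Submodule.ne_bot_iff _).1 hker
  set P := toPoly (k + 1) u with hP
  set Q := X * toPoly l v with hQ
  have hPdeg : P.natDegree ≤ k := natDegree_le_of_degree_le
    (Order.le_of_lt_succ (toPoly_deg (k + 1) u))
  have hQdeg : Q.natDegree ≤ l := by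
    refine (natDegree_mul_le).trans ?_
    have h := toPoly_deg l v
    by_cases h0 : toPoly l v = 0
    · simp [h0]
      omega
    · have := (natDegree_lt_iff_degree_lt h0).2 h
      rw [natDegree_X]
      omega
  have hcoeff (i : ℕ) (hi : i ∈ S) : (P.comp b - Q.comp d).coeff i = 0 :=
    congrFun (LinearMap.mem_ker.1 huv) ⟨i, hi⟩
  have hPQ : P.comp b = Q.comp d := by
    by_contra hne
    have hr : P.comp b - Q.comp d ≠ 0 := sub_ne_zero.2 hne
    refine leadingCoeff_ne_zero.2 hr (hcoeff _ ?_)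
    have hle : (P.comp b - Q.comp d).natDegree ≤ L := by
      refine (natDegree_sub_le _ _).trans (max_le ?_ ?_)
      · rw [natDegree_comp, hk, mul_comm]
        exact Nat.mul_le_mul_left _ hPdeg
      · rw [natDegree_comp, hl, mul_comm]
        exact Nat.mul_le_mul_left _ hQdeg
    have hlt := (hx.eval₂_C one_pos (P.comp b - Q.comp d)).2
    rw [one_pow, mul_one, mul_one, eval₂_sub, HahnSeries.coeff_sub, eval₂_comp, eval₂_comp] at hlt
    have hdvd : b.natDegree ∣ (P.comp b - Q.comp d).natDegree ∨
        d.natDegree ∣ (P.comp b - Q.comp d).natDegree := by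
      by_cases h0 : (P.eval₂ HahnSeries.C (b.eval₂ HahnSeries.C x)).coeff
          (-((P.comp b - Q.comp d).natDegree : ℤ)) = 0
      · right
        rw [h0, zero_sub] at hlt
        refine Int.natCast_dvd_natCast.1 (Int.dvd_neg.1 (eval₂_C_mem_dvdExponents hd Q _ ?_))
        intro h1
        rw [h1, neg_zero] at hlt
        exact leadingCoeff_ne_zero.2 hr hlt.symm
      · left
        exact Int.natCast_dvd_natCast.1 (Int.dvd_neg.1 (eval₂_C_mem_dvdExponents hb P _ h0))
    have hleft (i : ℕ) (hi : i ≤ k) : b.natDegree * i ∈ S :=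
      Finset.mem_union_left _ (Finset.mem_image.2 ⟨i, Finset.mem_range.2 (by omega), rfl⟩)
    rcases hdvd with ⟨i, hi⟩ | ⟨j, hj⟩
    · rw [hi]
      rw [hi, hk] at hle
      exact hleft i (Nat.le_of_mul_le_mul_left hle hb0)
    · have hjl : j ≤ l := by
        rw [hj, hl] at hle
        exact Nat.le_of_mul_le_mul_left hle hd0
      rw [hj]
      rcases Nat.eq_zero_or_pos j with rfl | hj0
      · simpa using hleft 0 (Nat.zero_le _)
      rcases hjl.eq_or_lt with rfl | hjl
      · rw [← hl, hk]
        exact hleft k le_rfl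
      · refine Finset.mem_union_right _ (Finset.mem_image.2 ⟨j - 1, ?_, ?_⟩)
        · rw [Finset.mem_range]
          omega
        · simp only [Nat.sub_add_cancel hj0]
  refine ⟨P, Q, hPQ, ?_⟩
  have hpos : 0 < (P.comp b).natDegree := by
    by_contra h0
    have h0 : (P.comp b).natDegree = 0 := by omega
    have hP0 : P.natDegree = 0 := by
      rw [natDegree_comp] at h0
      exact (mul_eq_zero.1 h0).resolve_right hb0.ne'
    have hQ0 : Q.natDegree = 0 := by
      rw [hPQ, natDegree_comp] at h0
      exact (mul_eq_zero.1 h0).resolve_right hd0.ne'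
    have hQz : Q = 0 := by
      rw [eq_C_of_natDegree_eq_zero hQ0, hQ, mul_coeff_zero, coeff_X_zero, zero_mul, C_0]
    have hPz : P = 0 := by
      rw [hQz, zero_comp, eq_C_of_natDegree_eq_zero hP0, C_comp] at hPQ
      rw [eq_C_of_natDegree_eq_zero hP0, hPQ]
    have hv : toPoly l v = 0 := by simpa [hQ, X_ne_zero] using hQz
    refine huv0 (Prod.ext (toPoly_inj _ ?_) (toPoly_inj _ ?_))
    · rw [Prod.fst_zero, map_zero]
      exact hPz
    · rw [Prod.snd_zero, map_zero]
      exact hv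
  refine le_antisymm ?_ (Nat.le_of_dvd hpos (Nat.lcm_dvd ?_ ?_))
  · rw [natDegree_comp, hk, mul_comm]
    exact Nat.mul_le_mul_left _ hPdeg
  · rw [natDegree_comp]
    exact dvd_mul_left _ _
  · rw [hPQ, natDegree_comp]
    exact dvd_mul_left _ _

/-- If `f = a ∘ b = c ∘ d` is tame, then `f` factors through a common left multiple of `b` and `d`
of degree `lcm (deg b) (deg d)`. -/
theorem exists_lcm_decomposition {a b c d : K[X]} (hn : ((a.comp b).natDegree : K) ≠ 0)
    (h : a.comp b = c.comp d) :
    ∃ t p q : K[X], a.comp b = t.comp (p.comp b) ∧ p.comp b = q.comp d ∧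
      (p.comp b).natDegree = Nat.lcm b.natDegree d.natDegree := by
  obtain ⟨x, hx, hfx⟩ := exists_eval₂_C_mem_dvdExponents hn
  have hb := hx.eval₂_C_mem_of_comp hn hfx
  have hb0 := pos_of_natCast_ne_zero (natDegree_cast_ne_zero_of_comp hn).2
  rw [h] at hn hfx
  have hd := hx.eval₂_C_mem_of_comp hn hfx
  have hd0 := pos_of_natCast_ne_zero (natDegree_cast_ne_zero_of_comp hn).2
  obtain ⟨p, q, hpq, hdeg⟩ := exists_comp_eq_comp_of_eval₂_C_mem hx hb0 hd0 hb hd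
  obtain ⟨t, ht⟩ := exists_eq_comp_of_dvd_natDegree ((aeval b).range ⊓ (aeval d).range)
    (e := p.comp b) ⟨⟨p, rfl⟩, q, hpq.symm⟩ (by rw [hdeg]; exact Nat.lcm_pos hb0 hd0)
    (by
      rintro _ ⟨⟨r, rfl⟩, s, hs⟩
      rw [hdeg]
      refine Nat.lcm_dvd ?_ ?_
      · exact (natDegree_comp (p := r) (q := b)).symm ▸ dvd_mul_left _ _
      · rw [← hs]
        exact (natDegree_comp (p := s) (q := d)).symm ▸ dvd_mul_left _ _)
    (r := a.comp b) ⟨⟨a, rfl⟩, c, h.symm⟩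
  exact ⟨t, p, q, ht, hpq, hdeg⟩

open IntermediateField

/-- A rational function of degree zero at infinity differs from a constant by a rational function
vanishing at infinity. -/
theorem exists_inftyValuation_sub_C_lt_one [DecidableEq (RatFunc K)] {r : RatFunc K}
    (hr : RatFunc.inftyValuation K r = 1) :
    ∃ α : K, RatFunc.inftyValuation K (r - algebraMap K (RatFunc K) α) < 1 := by
  have hr0 : r ≠ 0 := by
    rintro rfl
    simp at hr
  have hnum : r.num ≠ 0 := RatFunc.num_ne_zero hr0
  have hden : r.denom ≠ 0 := r.denom_ne_zero
  have hdeg : r.num.natDegree = r.denom.natDegree := by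
    rw [RatFunc.inftyValuation_apply, RatFunc.inftyValuation_of_nonzero _ hr0,
      WithZero.exp_eq_one] at hr
    rw [RatFunc.intDegree] at hr
    omega
  refine ⟨r.num.leadingCoeff / r.denom.leadingCoeff, ?_⟩
  set α := r.num.leadingCoeff / r.denom.leadingCoeff with hα
  have hα0 : α ≠ 0 := div_ne_zero (leadingCoeff_ne_zero.2 hnum) (leadingCoeff_ne_zero.2 hden)
  have hden' : algebraMap K[X] (RatFunc K) r.denom ≠ 0 := RatFunc.algebraMap_ne_zero hden
  have heq : r - algebraMap K (RatFunc K) α =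
      algebraMap K[X] (RatFunc K) (r.num - C α * r.denom) /
        algebraMap K[X] (RatFunc K) r.denom := by
    rw [eq_div_iff hden', sub_mul, map_sub, map_mul]
    congr 1
    nth_rw 1 [← RatFunc.num_div_denom r]
    rw [div_mul_cancel₀ _ hden']
  by_cases h0 : r.num - C α * r.denom = 0
  · rw [heq, h0, map_zero, zero_div, map_zero]
    exact zero_lt_one
  have hlt : (r.num - C α * r.denom).natDegree < r.denom.natDegree := by
    rw [← hdeg]
    refine natDegree_lt_natDegree h0 (degree_sub_lt_left ?_ hnum ?_)
    · rw [degree_C_mul hα0, degree_eq_natDegree hnum, degree_eq_natDegree hden, hdeg]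
    · rw [leadingCoeff_mul, leadingCoeff_C, hα,
        div_mul_cancel₀ _ (leadingCoeff_ne_zero.2 hden)]
  rw [heq, map_div₀, RatFunc.inftyValuation_apply, RatFunc.inftyValuation_apply,
    RatFunc.inftyValuation.polynomial _ h0, RatFunc.inftyValuation.polynomial _ hden,
    ← WithZero.exp_sub, ← WithZero.exp_zero, WithZero.exp_lt_exp]
  omega

/-- A nontrivial subfield of `K(X)` is generated by a rational function with a pole at infinity. -/
theorem exists_eq_adjoin_one_lt_inftyValuation [DecidableEq (RatFunc K)]
    {E : IntermediateField K (RatFunc K)} (hE : E ≠ ⊥) :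
    ∃ s : RatFunc K, E = K⟮s⟯ ∧ 1 < RatFunc.inftyValuation K s := by
  have hgen := RatFunc.Luroth.eq_adjoin_generator (E := E)
  have hnc := RatFunc.Luroth.generator_spec (E := E) hE
  set r := RatFunc.Luroth.generator E with hr
  have hinv (t : RatFunc K) : K⟮t⁻¹⟯ = K⟮t⟯ := by
    refine le_antisymm (adjoin_simple_le_iff.2 (inv_mem (mem_adjoin_simple_self K t)))
      (adjoin_simple_le_iff.2 ?_)
    simpa using inv_mem (mem_adjoin_simple_self K t⁻¹)
  have hsub (α : K) : K⟮r - algebraMap K (RatFunc K) α⟯ = K⟮r⟯ := by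
    refine le_antisymm (adjoin_simple_le_iff.2
      (sub_mem (mem_adjoin_simple_self K r) (IntermediateField.algebraMap_mem _ α)))
      (adjoin_simple_le_iff.2 ?_)
    simpa using add_mem (mem_adjoin_simple_self K (r - algebraMap K (RatFunc K) α))
      (IntermediateField.algebraMap_mem K⟮r - algebraMap K (RatFunc K) α⟯ α)
  have hne (α : K) : r - algebraMap K (RatFunc K) α ≠ 0 := fun h0 =>
    hnc ⟨α, (sub_eq_zero.1 h0).symm⟩
  have hlt (t : RatFunc K) (h0 : t ≠ 0) (h1 : RatFunc.inftyValuation K t < 1) :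
      1 < RatFunc.inftyValuation K t⁻¹ := by
    rw [map_inv₀]
    exact (one_lt_inv₀ (zero_lt_iff.2 ((Valuation.ne_zero_iff _).2 h0))).2 h1
  rcases lt_trichotomy (RatFunc.inftyValuation K r) 1 with h | h | h
  · refine ⟨r⁻¹, by rw [hinv, ← hgen], hlt r ?_ h⟩
    simpa using hne 0
  · obtain ⟨α, hα⟩ := exists_inftyValuation_sub_C_lt_one h
    exact ⟨(r - algebraMap K (RatFunc K) α)⁻¹, by rw [hinv, hsub, ← hgen], hlt _ (hne α) hα⟩
  · exact ⟨r, hgen, h⟩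

/-- Polynomial form of Lüroth's theorem: a subfield of `K(X)` containing a nonconstant polynomial is
generated by a polynomial. -/
theorem exists_eq_adjoin_polynomial {E : IntermediateField K (RatFunc K)} {b : K[X]}
    (hb0 : 0 < b.natDegree) (hb : algebraMap K[X] (RatFunc K) b ∈ E) :
    ∃ w : K[X], E = K⟮algebraMap K[X] (RatFunc K) w⟯ := by
  classical
  have hbz : b ≠ 0 := by
    rintro rfl
    simp at hb0
  have hvb : 1 < RatFunc.inftyValuation K (algebraMap K[X] (RatFunc K) b) := by
    rw [RatFunc.inftyValuation_apply, RatFunc.inftyValuation.polynomial _ hbz,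
      ← WithZero.exp_zero, WithZero.exp_lt_exp]
    exact_mod_cast hb0
  have hE : E ≠ ⊥ := by
    rintro rfl
    obtain ⟨c, hc⟩ := IntermediateField.mem_bot.1 hb
    have h : (C c : K[X]) = b := RatFunc.algebraMap_injective K hc
    rw [← h, natDegree_C] at hb0
    exact lt_irrefl _ hb0
  obtain ⟨s, hs, hvs⟩ := exists_eq_adjoin_one_lt_inftyValuation hE
  rw [hs] at hb
  obtain ⟨P, Q, hPQ⟩ := (mem_adjoin_simple_iff _ _).1 hb
  have hbz' : algebraMap K[X] (RatFunc K) b ≠ 0 := RatFunc.algebraMap_ne_zero hbz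
  have hQs : aeval s Q ≠ 0 := by
    intro h0
    rw [h0, div_zero] at hPQ
    exact hbz' hPQ
  have hP0 : P ≠ 0 := by
    rintro rfl
    rw [map_zero, zero_div] at hPQ
    exact hbz' hPQ
  have hQ0 : Q ≠ 0 := by
    rintro rfl
    simp at hQs
  have hmul : aeval s P = algebraMap K[X] (RatFunc K) b * aeval s Q := by
    rw [hPQ, div_mul_cancel₀ _ hQs]
  have hdeg : Q.natDegree < P.natDegree := by
    have h := congrArg (RatFunc.inftyValuation K) hmul
    rw [map_mul, valuation_aeval_eq_valuation_X_pow_natDegree_of_one_lt_valuation_X _ hvs hP0,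
      valuation_aeval_eq_valuation_X_pow_natDegree_of_one_lt_valuation_X _ hvs hQ0] at h
    rw [← pow_lt_pow_iff_right₀ hvs, h]
    exact lt_mul_of_one_lt_left (pow_pos (zero_lt_one.trans hvs) _) hvb
  have hlc : P.leadingCoeff⁻¹ ≠ 0 := inv_ne_zero (leadingCoeff_ne_zero.2 hP0)
  have hs_int : IsIntegral K[X] s := by
    refine ⟨(C P.leadingCoeff⁻¹ * P).map C - C (C P.leadingCoeff⁻¹ * b) * Q.map C, ?_, ?_⟩
    · refine Monic.sub_of_left (Monic.map _ ?_) ?_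
      · rw [Monic, leadingCoeff_mul, leadingCoeff_C,
          inv_mul_cancel₀ (leadingCoeff_ne_zero.2 hP0)]
      · rw [degree_map, degree_C_mul hlc]
        refine (degree_mul_le _ _).trans_lt ?_
        rw [degree_map]
        refine (add_le_add_left degree_C_le _).trans_lt ?_
        rw [zero_add]
        exact degree_lt_degree hdeg
    · have hC (p : K[X]) : (p.map C).eval₂ (algebraMap K[X] (RatFunc K)) s = aeval s p := by
        rw [eval₂_map, aeval_def]
        rfl
      rw [eval₂_sub, eval₂_mul, eval₂_C, hC, hC, map_mul, map_mul, hmul, aeval_C, mul_assoc]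
      exact sub_self _
  obtain ⟨w, hw⟩ := IsIntegrallyClosed.isIntegral_iff.1 hs_int
  exact ⟨w, hw ▸ hs⟩

/-- A polynomial which is a rational function of the polynomial `w` is a polynomial in `w`. -/
theorem exists_eq_comp_of_mem_adjoin {w b : K[X]} (hb0 : 0 < b.natDegree)
    (hb : algebraMap K[X] (RatFunc K) b ∈ K⟮algebraMap K[X] (RatFunc K) w⟯) :
    ∃ u : K[X], b = u.comp w := by
  obtain ⟨P, Q, hPQ⟩ := (mem_adjoin_simple_iff _ _).1 hb
  have haeval (p : K[X]) : aeval (algebraMap K[X] (RatFunc K) w) p =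
      algebraMap K[X] (RatFunc K) (p.comp w) := by
    rw [aeval_algebraMap_apply]
    rfl
  rw [haeval, haeval] at hPQ
  have hQw : Q.comp w ≠ 0 := by
    intro h0
    rw [h0, map_zero, div_zero, map_eq_zero_iff _ (RatFunc.algebraMap_injective K)] at hPQ
    simp [hPQ] at hb0
  have hQ0 : Q ≠ 0 := by
    rintro rfl
    simp at hQw
  rw [eq_div_iff (RatFunc.algebraMap_ne_zero hQw), ← map_mul] at hPQ
  have hmul : b * Q.comp w = P.comp w := RatFunc.algebraMap_injective K hPQ
  have hw0 : 0 < w.natDegree := by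
    by_contra h0
    have hd := congrArg natDegree hmul
    have hbz : b ≠ 0 := by
      rintro rfl
      simp at hb0
    rw [natDegree_mul hbz hQw, natDegree_comp, natDegree_comp] at hd
    have h0 : w.natDegree = 0 := by omega
    rw [h0] at hd
    omega
  refine ⟨P / Q, ?_⟩
  have hdiv : (b - (P / Q).comp w) * Q.comp w = (P % Q).comp w := by
    rw [sub_mul, hmul, ← mul_comp, sub_eq_iff_eq_add, ← add_comp]
    congr 1
    rw [add_comm, mul_comm, EuclideanDomain.div_add_mod]
  by_contra hne
  have hne : b - (P / Q).comp w ≠ 0 := sub_ne_zero.2 hne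
  have hR : P % Q ≠ 0 := by
    intro h0
    rw [h0, zero_comp] at hdiv
    exact (mul_ne_zero hne hQw) hdiv
  have hlt : (P % Q).natDegree < Q.natDegree :=
    natDegree_lt_natDegree hR (EuclideanDomain.mod_lt P hQ0)
  have hd := congrArg natDegree hdiv
  rw [natDegree_mul hne hQw, natDegree_comp, natDegree_comp] at hd
  have := Nat.mul_lt_mul_of_pos_right hlt hw0
  omega

/-- If `f = a ∘ b = c ∘ d` is tame, then `b` and `d` have a common right component of degree
`gcd (deg b) (deg d)`. -/
theorem exists_gcd_decomposition {a b c d : K[X]} (hn : ((a.comp b).natDegree : K) ≠ 0)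
    (h : a.comp b = c.comp d) :
    ∃ w u v : K[X], b = u.comp w ∧ d = v.comp w ∧
      w.natDegree = Nat.gcd b.natDegree d.natDegree := by
  obtain ⟨x, hx, hfx⟩ := exists_eval₂_C_mem_dvdExponents hn
  have hb := hx.eval₂_C_mem_of_comp hn hfx
  have hb0 := pos_of_natCast_ne_zero (natDegree_cast_ne_zero_of_comp hn).2
  rw [h] at hn hfx
  have hd := hx.eval₂_C_mem_of_comp hn hfx
  have hd0 := pos_of_natCast_ne_zero (natDegree_cast_ne_zero_of_comp hn).2
  set g := Nat.gcd b.natDegree d.natDegree with hg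
  let ι : K[X] →ₐ[K] RatFunc K := IsScalarTower.toAlgHom K K[X] (RatFunc K)
  have hbE : algebraMap K[X] (RatFunc K) b ∈ adjoin K (ι '' {b, d}) :=
    subset_adjoin _ _ ⟨b, by simp, rfl⟩
  have hdE : algebraMap K[X] (RatFunc K) d ∈ adjoin K (ι '' {b, d}) :=
    subset_adjoin _ _ ⟨d, by simp, rfl⟩
  obtain ⟨w, hw⟩ := exists_eq_adjoin_polynomial hb0 hbE
  obtain ⟨u, hu⟩ := exists_eq_comp_of_mem_adjoin hb0 (hw ▸ hbE)
  obtain ⟨v, hv⟩ := exists_eq_comp_of_mem_adjoin hd0 (hw ▸ hdE)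
  refine ⟨w, u, v, hu, hv, Nat.dvd_antisymm (Nat.dvd_gcd ?_ ?_) ?_⟩
  · exact hu ▸ natDegree_comp (p := u) (q := w) ▸ dvd_mul_left _ _
  · exact hv ▸ natDegree_comp (p := v) (q := w) ▸ dvd_mul_left _ _
  have hwz : w ≠ 0 := by
    rintro rfl
    rw [hu, comp_zero, natDegree_C] at hb0
    exact lt_irrefl _ hb0
  have hmem (p : K[X]) (hp : p ∈ Algebra.adjoin K {b, d}) : g ∣ p.natDegree := by
    refine hx.dvd_natDegree ?_
    induction hp using Algebra.adjoin_induction with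
    | mem p hp =>
      rcases hp with rfl | rfl
      · exact dvdExponents_anti (Nat.gcd_dvd_left _ _) hb
      · exact dvdExponents_anti (Nat.gcd_dvd_right _ _) hd
    | algebraMap r =>
      rw [algebraMap_eq, eval₂_C]
      exact C_mem_dvdExponents _ _
    | add p q _ _ hp hq => exact eval₂_add (f := HahnSeries.C) (x := x) ▸ add_mem hp hq
    | mul p q _ _ hp hq => exact eval₂_mul (f := HahnSeries.C) (x := x) ▸ mul_mem hp hq
  have hwE : ι w ∈ adjoin K (ι '' {b, d}) := hw ▸ mem_adjoin_simple_self K _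
  obtain ⟨r, hr, s, hs, hrs⟩ := mem_adjoin_iff_div.1 hwE
  rw [← AlgHom.map_adjoin] at hr hs
  obtain ⟨P, hP, rfl⟩ := hr
  obtain ⟨Q, hQ, rfl⟩ := hs
  have hinj : Function.Injective ι := RatFunc.algebraMap_injective K
  have hQz : Q ≠ 0 := by
    rintro rfl
    have h0 : ι w = 0 := by
      rw [hrs]
      simp
    exact hwz (hinj (h0.trans (map_zero ι).symm))
  have hwQ : w * Q = P := hinj (by
    rw [map_mul, hrs]
    exact div_mul_cancel₀ _ ((map_ne_zero_iff _ hinj).2 hQz))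
  have hdeg := hmem P hP
  rw [← hwQ, natDegree_mul hwz hQz] at hdeg
  exact (Nat.dvd_add_left (hmem Q hQ)).1 hdeg

theorem comp_right_cancel {a b e : K[X]} (he : 0 < e.natDegree) (h : a.comp e = b.comp e) :
    a = b := by
  have h0 : (a - b).comp e = 0 := by rw [sub_comp, h, sub_self]
  rcases comp_eq_zero_iff.1 h0 with h1 | ⟨_, h1⟩
  · exact sub_eq_zero.1 h1
  · rw [h1, natDegree_C] at he
    exact absurd he (lt_irrefl _)

theorem exists_comp_eq_X_of_natDegree_eq_one {l : K[X]} (hl : l.natDegree = 1) :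
    ∃ l' : K[X], l'.natDegree = 1 ∧ l'.comp l = X := by
  obtain ⟨a, ha, b, rfl⟩ := natDegree_eq_one.1 hl
  refine ⟨C a⁻¹ * (X - C b), ?_, ?_⟩
  · rw [natDegree_C_mul (inv_ne_zero ha), natDegree_X_sub_C]
  · rw [mul_comp, C_comp, sub_comp, X_comp, C_comp, add_sub_cancel_right, ← mul_assoc, ← C_mul,
      inv_mul_cancel₀ ha, C_1, one_mul]

theorem _root_.Polynomial.Indecomposable.linear_comp {l g : K[X]} (hl : l.natDegree = 1)
    (hg : g.Indecomposable) : (l.comp g).Indecomposable := by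
  intro g₁ h₁ h
  obtain ⟨l', hl', hll⟩ := exists_comp_eq_X_of_natDegree_eq_one hl
  have := hg (l'.comp g₁) h₁ (by rw [comp_assoc, ← h, ← comp_assoc, hll, X_comp])
  rwa [natDegree_comp, hl', one_mul] at this

/-- `HasDecomposition f M`: up to a linear right factor, `f` is a composition of indecomposable
polynomials whose degrees form the multiset `M`. -/
inductive HasDecomposition : K[X] → Multiset ℕ → Prop
  | linear (l : K[X]) (hl : l.natDegree = 1) : HasDecomposition l 0
  | comp (g G : K[X]) (M : Multiset ℕ) (hdeg : 2 ≤ g.natDegree) (hg : g.Indecomposable)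
      (hG : HasDecomposition G M) : HasDecomposition (g.comp G) (g.natDegree ::ₘ M)

namespace HasDecomposition

theorem natDegree_pos {f : K[X]} {M : Multiset ℕ} (h : HasDecomposition f M) :
    0 < f.natDegree := by
  induction h with
  | linear l hl => omega
  | comp g G M hdeg hg hG ih =>
    rw [natDegree_comp]
    exact Nat.mul_pos (by omega) ih

theorem linear_comp {f l : K[X]} {M : Multiset ℕ} (hl : l.natDegree = 1)
    (h : HasDecomposition f M) : HasDecomposition (l.comp f) M := by
  cases h with
  | linear _ hf => exact linear _ (by rw [natDegree_comp, hl, hf])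
  | comp g G M hdeg hg hG =>
    have hd : (l.comp g).natDegree = g.natDegree := by rw [natDegree_comp, hl, one_mul]
    rw [← comp_assoc, ← hd]
    exact comp _ _ _ (hd ▸ hdeg) (hg.linear_comp hl) hG

theorem append {f g : K[X]} {M N : Multiset ℕ} (hf : HasDecomposition f M)
    (hg : HasDecomposition g N) : HasDecomposition (f.comp g) (M + N) := by
  induction hf with
  | linear l hl =>
    rw [zero_add]
    exact hg.linear_comp hl
  | comp f F M hdeg hf hF ih =>
    rw [comp_assoc, Multiset.cons_add]
    exact comp _ _ _ hdeg hf ih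

theorem cases_comp {f : K[X]} {M : Multiset ℕ} (h : HasDecomposition f M) :
    (f.natDegree = 1 ∧ M = 0) ∨ ∃ (g G : K[X]) (N : Multiset ℕ), 2 ≤ g.natDegree ∧
      g.Indecomposable ∧ HasDecomposition G N ∧ f = g.comp G ∧ M = g.natDegree ::ₘ N := by
  cases h with
  | linear _ hf => exact Or.inl ⟨hf, rfl⟩
  | comp g G N hdeg hg hG => exact Or.inr ⟨g, G, N, hdeg, hg, hG, rfl, rfl⟩

end HasDecomposition

theorem exists_hasDecomposition {f : K[X]} (hf : 0 < f.natDegree) :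
    ∃ M, HasDecomposition f M := by
  induction hn : f.natDegree using Nat.strong_induction_on generalizing f with
  | _ n ih =>
  by_cases h1 : f.natDegree = 1
  · exact ⟨0, .linear f h1⟩
  by_cases hi : f.Indecomposable
  · have h := HasDecomposition.comp f X 0 (by omega) hi (.linear X natDegree_X)
    rw [comp_X] at h
    exact ⟨_, h⟩
  rw [Polynomial.Indecomposable] at hi
  push Not at hi
  obtain ⟨g, h, rfl, hg, hh⟩ := hi
  rw [natDegree_comp] at hf hn
  have hg0 := Nat.pos_of_mul_pos_right hf
  have hh0 := Nat.pos_of_mul_pos_left hf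
  obtain ⟨M, hM⟩ := ih g.natDegree (by nlinarith [show 2 ≤ h.natDegree by omega]) hg0 rfl
  obtain ⟨N, hN⟩ := ih h.natDegree (by nlinarith [show 2 ≤ g.natDegree by omega]) hh0 rfl
  exact ⟨M + N, hM.append hN⟩

/-- In a tame equation `g ∘ u ∘ w = h ∘ v ∘ w` with `deg u = deg h` coprime to `deg v`,
indecomposability of `h` is inherited by `u`. -/
theorem indecomposable_of_comp_eq_comp {g h u v w : K[X]}
    (hn : ((g.comp (u.comp w)).natDegree : K) ≠ 0)
    (heq : g.comp (u.comp w) = h.comp (v.comp w)) (hh : h.Indecomposable)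
    (hdeg : h.natDegree = u.natDegree) (hcop : Nat.Coprime u.natDegree v.natDegree) :
    u.Indecomposable := by
  rintro u₁ u₂ rfl
  have hassoc : g.comp ((u₁.comp u₂).comp w) = (g.comp u₁).comp (u₂.comp w) := by
    simp only [comp_assoc]
  rw [hassoc] at heq hn
  obtain ⟨t, p, q, ht, hpq, hlcm⟩ := exists_lcm_decomposition hn heq
  have hvw : 0 < (v.comp w).natDegree := by
    rw [heq] at hn
    exact pos_of_natCast_ne_zero (natDegree_cast_ne_zero_of_comp hn).2
  have hh' : h = t.comp q := comp_right_cancel hvw (by rw [← heq, ht, hpq, comp_assoc])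
  rw [natDegree_comp] at hdeg hcop hvw
  have hw := Nat.pos_of_mul_pos_left hvw
  rw [hpq, natDegree_comp, natDegree_comp, natDegree_comp, Nat.lcm_mul_right,
    (Nat.Coprime.coprime_mul_left hcop).lcm_eq_mul, ← mul_assoc] at hlcm
  have hv := Nat.pos_of_mul_pos_right hvw
  have hq : q.natDegree = u₂.natDegree :=
    Nat.eq_of_mul_eq_mul_right hv (Nat.eq_of_mul_eq_mul_right hw hlcm)
  rcases hh t q hh' with h1 | h1
  · left
    have hu₂ : 0 < u₂.natDegree :=
      pos_of_natCast_ne_zero (natDegree_cast_ne_zero_of_comp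
        (natDegree_comp (p := u₂) (q := w) ▸ (natDegree_cast_ne_zero_of_comp hn).2 :
          ((u₂.comp w).natDegree : K) ≠ 0)).1
    rw [hh', natDegree_comp, h1, hq] at hdeg
    exact (Nat.eq_of_mul_eq_mul_right hu₂ hdeg).symm
  · right
    rw [← hq, h1]

/-- The multiset of degrees of a complete decomposition of a tame polynomial is unique. -/
theorem HasDecomposition.unique {f : K[X]} (hf : (f.natDegree : K) ≠ 0) {M N : Multiset ℕ}
    (hM : HasDecomposition f M) (hN : HasDecomposition f N) : M = N := by
  induction hn : f.natDegree using Nat.strong_induction_on generalizing f M N with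
  | _ n ih =>
  rcases hM.cases_comp with ⟨h1, rfl⟩ | ⟨g, G, M, hg2, hg, hG, hfg, rfl⟩
  · rcases hN.cases_comp with ⟨-, rfl⟩ | ⟨h, H, N, hh2, hh, hH, hfh, rfl⟩
    · rfl
    · rw [hfh, natDegree_comp] at h1
      have := Nat.dvd_one.1 (Dvd.intro _ h1)
      omega
  rcases hN.cases_comp with ⟨h1, rfl⟩ | ⟨h, H, N, hh2, hh, hH, hfh, rfl⟩
  · rw [hfg, natDegree_comp] at h1
    have := Nat.dvd_one.1 (Dvd.intro _ h1)
    omega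
  have hfG := hfg ▸ hf
  have hfH := hfh ▸ hf
  have hgG : g.comp G = h.comp H := hfg.symm.trans hfh
  have hG0 := hG.natDegree_pos
  have hH0 := hH.natDegree_pos
  have hGn : G.natDegree < n := by
    rw [← hn, hfg, natDegree_comp]
    nlinarith
  have hHn : H.natDegree < n := by
    rw [← hn, hfh, natDegree_comp]
    nlinarith
  have hGt := (natDegree_cast_ne_zero_of_comp hfG).2
  have hHt := (natDegree_cast_ne_zero_of_comp hfH).2
  obtain ⟨t, p, q, ht, hpq, hlcm⟩ := exists_lcm_decomposition hfG hgG
  have hgt : g = t.comp p := comp_right_cancel hG0 (by rw [ht, comp_assoc])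
  have hht : h = t.comp q := comp_right_cancel hH0 (by rw [← hgG, ht, hpq, comp_assoc])
  by_cases ht1 : t.natDegree = 1
  · obtain ⟨w, u, v, hGu, hHv, hw⟩ := exists_gcd_decomposition hfG hgG
    have hw0 : 0 < w.natDegree := hw ▸ Nat.gcd_pos_of_pos_left _ hG0
    have hdG : G.natDegree = u.natDegree * w.natDegree := hGu ▸ natDegree_comp
    have hdH : H.natDegree = v.natDegree * w.natDegree := hHv ▸ natDegree_comp
    have hu0 : 0 < u.natDegree := Nat.pos_of_mul_pos_right (hdG ▸ hG0)
    have hv0 : 0 < v.natDegree := Nat.pos_of_mul_pos_right (hdH ▸ hH0)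
    have hcop : Nat.Coprime u.natDegree v.natDegree := by
      rw [hdG, hdH, Nat.gcd_mul_right] at hw
      exact Nat.eq_of_mul_eq_mul_right hw0 (by rw [one_mul, ← hw])
    have hdeg : (g.comp G).natDegree = u.natDegree * v.natDegree * w.natDegree := by
      rw [ht, natDegree_comp, ht1, one_mul, hlcm, hdG, hdH, Nat.lcm_mul_right, hcop.lcm_eq_mul]
    have hgv : g.natDegree = v.natDegree := by
      rw [natDegree_comp, hdG] at hdeg
      refine Nat.eq_of_mul_eq_mul_right (Nat.mul_pos hu0 hw0) ?_
      rw [hdeg]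
      ring
    have hhu : h.natDegree = u.natDegree := by
      rw [hgG, natDegree_comp, hdH] at hdeg
      refine Nat.eq_of_mul_eq_mul_right (Nat.mul_pos hv0 hw0) ?_
      rw [hdeg]
      ring
    subst hGu hHv
    have hu := indecomposable_of_comp_eq_comp hfG hgG hh hhu hcop
    have hv := indecomposable_of_comp_eq_comp hfH hgG.symm hg hgv hcop.symm
    obtain ⟨Q, hQ⟩ := exists_hasDecomposition hw0
    rw [ih _ hGn hGt hG (.comp u w Q (hhu ▸ hh2) hu hQ) rfl,
      ih _ hHn hHt hH (.comp v w Q (hgv ▸ hg2) hv hQ) rfl, hgv, hhu, Multiset.cons_swap]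
  · have hp1 := (hg t p hgt).resolve_left ht1
    have hq1 := (hh t q hht).resolve_left ht1
    have hpG : (p.comp G).natDegree = G.natDegree := by rw [natDegree_comp, hp1, one_mul]
    rw [ih _ hGn (hpG.symm ▸ hGt) (hG.linear_comp hp1) (hpq ▸ hH.linear_comp hq1) hpG, hgt, hht,
      natDegree_comp, natDegree_comp, hp1, hq1]

theorem hasDecomposition_foldr {gs : List K[X]}
    (hgs : ∀ g ∈ gs, 2 ≤ g.natDegree ∧ g.Indecomposable) :
    HasDecomposition (gs.foldr Polynomial.comp X) (gs.map natDegree : Multiset ℕ) := by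
  induction gs with
  | nil => exact .linear X natDegree_X
  | cons g gs ih =>
    obtain ⟨hg2, hg⟩ := hgs g List.mem_cons_self
    exact .comp g _ _ hg2 hg (ih fun g' hg' => hgs g' (List.mem_cons_of_mem _ hg'))

end Ritt

/-- Ritt's First Theorem (length and degrees): any two complete decompositions of a tame
polynomial have the same length and the same multiset of degrees of the components. -/
theorem ritt_first_theorem_lengths {K : Type*} [Field K] (f : K[X])
    (hdeg : 2 ≤ f.natDegree) (htame : ¬ (ringChar K ∣ f.natDegree))
    (gs hs : List K[X])
    (hgs : ∀ g ∈ gs, 2 ≤ g.natDegree ∧ g.Indecomposable)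
    (hhs : ∀ h ∈ hs, 2 ≤ h.natDegree ∧ h.Indecomposable)
    (hfg : f = gs.foldr Polynomial.comp X)
    (hfh : f = hs.foldr Polynomial.comp X) :
    gs.length = hs.length ∧
      (↑(gs.map Polynomial.natDegree) : Multiset ℕ) = ↑(hs.map Polynomial.natDegree) := by
  have htame' : (f.natDegree : K) ≠ 0 := fun h => htame (ringChar.dvd h)
  have h : (↑(gs.map Polynomial.natDegree) : Multiset ℕ) = ↑(hs.map Polynomial.natDegree) :=
    Ritt.HasDecomposition.unique htame' (hfg ▸ Ritt.hasDecomposition_foldr hgs)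
      (hfh ▸ Ritt.hasDecomposition_foldr hhs)
  exact ⟨by simpa using congrArg Multiset.card h, h⟩
end

section
/- Every finite subgroup H of the group Aut_ℚ ℚ(x) of ℚ-algebra automorphisms of the rational function field ℚ(x) = RatFunc ℚ (a group isomorphic to PGL₂(ℚ)) is either trivial or isomorphic to a cyclic group C_n = ZMod n or to a dihedral group D_n = DihedralGroup n for some n ∈ {2, 3, 4, 6}. -/
open Matrix ComplexConjugate

section GroupTheory

variable {G : Type*} [Group G]

/-- A group with a cyclic subgroup `N` of index two outside of which every element squares to `1`
is dihedral. -/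
theorem nonempty_mulEquiv_dihedralGroup (N : Subgroup G) [IsCyclic N] {x : G} (hx : x ∉ N)
    (hmem : ∀ g h : G, g * h ∈ N ↔ (g ∈ N ↔ h ∈ N)) (hsq : ∀ g ∉ N, g * g = 1) :
    Nonempty (G ≃* DihedralGroup (Nat.card N)) := by
  let e : Multiplicative (ZMod (Nat.card N)) ≃* N := zmodCyclicMulEquiv inferInstance
  let ρ : ZMod (Nat.card N) → G := fun i ↦ e (Multiplicative.ofAdd i)
  have hρmem (i) : ρ i ∈ N := (e _).2
  have hρadd (i j) : ρ (i + j) = ρ i * ρ j := by simp [ρ, ofAdd_add]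
  have hρinj {i j} (h : ρ i = ρ j) : i = j := by simpa [ρ] using h
  have hρsurj {g} (hg : g ∈ N) : ∃ i, ρ i = g :=
    ⟨(e.symm ⟨g, hg⟩).toAdd, by simp [ρ]⟩
  have hxx : x * x = 1 := hsq x hx
  have hconj (i) : ρ i * x * ρ i = x := by
    have h := hsq (x * ρ i) (by rw [hmem]; exact fun h ↦ hx (h.2 (hρmem i)))
    calc ρ i * x * ρ i = x * x * (ρ i * x * ρ i) := by rw [hxx, one_mul]
      _ = x * (x * ρ i * (x * ρ i)) := by simp only [mul_assoc]
      _ = x := by rw [h, mul_one]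
  have hρx (i j) : ρ i * (x * ρ j) = x * ρ (j - i) := by
    calc ρ i * (x * ρ j) = ρ i * x * ρ (i + (j - i)) := by rw [add_sub_cancel, mul_assoc]
      _ = ρ i * x * ρ i * ρ (j - i) := by rw [hρadd, ← mul_assoc]
      _ = x * ρ (j - i) := by rw [hconj]
  let f : DihedralGroup (Nat.card N) → G
    | .r i => ρ i
    | .sr i => x * ρ i
  have hf (a b) : f (a * b) = f a * f b := by
    rcases a with i | i <;> rcases b with j | j
    · exact hρadd i j
    · exact (hρx i j).symm
    · change x * ρ (i + j) = x * ρ i * ρ j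
      rw [hρadd, mul_assoc]
    · change ρ (j - i) = x * ρ i * (x * ρ j)
      rw [mul_assoc, hρx, ← mul_assoc, hxx, one_mul]
  have hne (i j) : ρ i ≠ x * ρ j := fun h ↦ by
    have := hρmem i
    rw [h, hmem] at this
    exact hx (this.2 (hρmem j))
  have hbij : Function.Bijective f := by
    constructor
    · rintro (i | i) (j | j) h
      · exact congrArg _ (hρinj h)
      · exact (hne i j h).elim
      · exact (hne j i h.symm).elim
      · exact congrArg _ (hρinj (mul_left_cancel h))
    · intro g
      by_cases hg : g ∈ N
      · obtain ⟨i, hi⟩ := hρsurj hg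
        exact ⟨.r i, hi⟩
      · obtain ⟨i, hi⟩ := hρsurj ((hmem x g).2 (iff_of_false hx hg))
        refine ⟨.sr i, ?_⟩
        change x * ρ i = g
        rw [hi, ← mul_assoc, hxx, one_mul]
  exact ⟨(MulEquiv.ofBijective (MulHom.mk f hf) hbij).symm⟩

end GroupTheory

/-- The order of a complex root of unity with rational trace `ζ + ζ⁻¹`. -/
theorem orderOf_mem_of_add_inv_rat {ζ : ℂ} (hfin : IsOfFinOrder ζ) {t : ℚ}
    (ht : ζ + ζ⁻¹ = t) : orderOf ζ ∈ ({1, 2, 3, 4, 6} : Set ℕ) := by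
  obtain ⟨n, hn, hζ⟩ := isOfFinOrder_iff_pow_eq_one.1 hfin
  have hnorm : ‖ζ‖ = 1 := Complex.norm_eq_one_of_pow_eq_one hζ hn.ne'
  have h0 : ζ ≠ 0 := by rintro rfl; simp at hnorm
  have hint {z : ℂ} (hz : z ^ n = 1) : IsIntegral ℤ z :=
    IsIntegral.of_pow hn (hz ▸ isIntegral_one)
  have htint : IsIntegral ℤ (algebraMap ℚ ℂ t) := by
    have := (hint hζ).add (hint (z := ζ⁻¹) (by rw [inv_pow, hζ, inv_one]))
    rw [ht] at this
    simpa using this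
  rw [isIntegral_algebraMap_iff (algebraMap ℚ ℂ).injective] at htint
  obtain ⟨z, rfl⟩ := IsIntegrallyClosed.isIntegral_iff.1 htint
  have hz : |(z : ℝ)| ≤ 2 := by
    have h := norm_add_le ζ ζ⁻¹
    rw [ht, norm_inv, hnorm] at h
    norm_num at h
    exact h
  have hz' : |z| ≤ 2 := by exact_mod_cast hz
  have hq : ζ ^ 2 + 1 = z * ζ := by
    have : (z : ℂ) = ζ + ζ⁻¹ := by rw [ht]; simp
    rw [this]; field_simp
  have hdvd : ∃ m ∈ ({1, 2, 3, 4, 6} : Finset ℕ), ζ ^ m = 1 := by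
    obtain ⟨h1, h2⟩ := abs_le.1 hz'
    interval_cases z <;> push_cast at hq
    · have : (ζ + 1) ^ 2 = 0 := by linear_combination hq
      have : ζ = -1 := eq_neg_of_add_eq_zero_left (pow_eq_zero_iff two_ne_zero |>.1 this)
      exact ⟨2, by simp, by simp [this]⟩
    · exact ⟨3, by simp, by linear_combination (ζ - 1) * hq⟩
    · exact ⟨4, by simp, by linear_combination (ζ ^ 2 - 1) * hq⟩
    · exact ⟨6, by simp, by linear_combination (ζ ^ 3 - 1) * (ζ + 1) * hq⟩
    · have : (ζ - 1) ^ 2 = 0 := by linear_combination hq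
      have : ζ = 1 := sub_eq_zero.1 (pow_eq_zero_iff two_ne_zero |>.1 this)
      exact ⟨1, by simp, by simp [this]⟩
  obtain ⟨m, hm, hζm⟩ := hdvd
  have hd := orderOf_dvd_of_pow_eq_one hζm
  have hle : orderOf ζ ≤ 6 := (Nat.le_of_dvd (by fin_cases hm <;> simp) hd).trans
    (by fin_cases hm <;> simp)
  generalize orderOf ζ = k at hd hle
  fin_cases hm <;> interval_cases k <;> simp_all

section ProjectiveRepresentation

/-- The quadratic form `‖m (x, y)‖² / |det m|`, which depends on `m` only up to scaling. -/
noncomputable def normForm {K : Type*} [Field K] (m : Matrix (Fin 2) (Fin 2) ℚ) (x y : K) : K :=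
  ((m 0 0 * x + m 0 1 * y) ^ 2 + (m 1 0 * x + m 1 1 * y) ^ 2) / (|m.det| : ℚ)

theorem normForm_pos {m : Matrix (Fin 2) (Fin 2) ℚ} (hm : m.det ≠ 0) {x y : ℝ}
    (hxy : x ≠ 0 ∨ y ≠ 0) : 0 < normForm m x y := by
  refine div_pos ?_ (by exact_mod_cast abs_pos.2 hm)
  by_contra! h
  have h1 : (m 0 0 : ℝ) * x + m 0 1 * y = 0 := by
    rw [← sq_eq_zero_iff]; nlinarith [sq_nonneg ((m 0 0 : ℝ) * x + m 0 1 * y),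
      sq_nonneg ((m 1 0 : ℝ) * x + m 1 1 * y)]
  have h2 : (m 1 0 : ℝ) * x + m 1 1 * y = 0 := by
    rw [← sq_eq_zero_iff]; nlinarith [sq_nonneg ((m 0 0 : ℝ) * x + m 0 1 * y),
      sq_nonneg ((m 1 0 : ℝ) * x + m 1 1 * y)]
  have hdet : (m 0 0 : ℝ) * m 1 1 - m 0 1 * m 1 0 ≠ 0 := by
    rw [det_fin_two] at hm; exact_mod_cast hm
  rcases hxy with hx | hy
  · exact mul_ne_zero hdet hx (by linear_combination m 1 1 * h1 - m 0 1 * h2)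
  · exact mul_ne_zero hdet hy (by linear_combination m 0 0 * h2 - m 1 0 * h1)

theorem normForm_smul_mul {K : Type*} [Field K] [CharZero K] {m k : Matrix (Fin 2) (Fin 2) ℚ}
    {s : ℚ} (hs : s ≠ 0) (x y : K) :
    normForm (s • (m * k)) x y =
      normForm m (k 0 0 * x + k 0 1 * y) (k 1 0 * x + k 1 1 * y) / (|k.det| : ℚ) := by
  have h : |(s • (m * k)).det| = s ^ 2 * (|m.det| * |k.det|) := by
    rw [det_smul, det_mul, abs_mul, abs_mul, Fintype.card_fin, abs_of_nonneg (sq_nonneg s)]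
  have hs' : ((s ^ 2 : ℚ) : K) ≠ 0 := by exact_mod_cast pow_ne_zero 2 hs
  rw [normForm, normForm, h, div_div, Rat.cast_mul, Rat.cast_mul,
    ← mul_div_mul_left _ ((|m.det| : ℚ) * (|k.det| : ℚ) : K) hs']
  congr 1
  simp [mul_apply, Fin.sum_univ_two]
  ring

variable {G : Type*} [Group G] [Finite G] {M : G → Matrix (Fin 2) (Fin 2) ℚ}

/-- A finite group of rational projective transformations preserves a pair of complex conjugate
points of the projective line. -/
theorem exists_conj_pair_fixed (hdet : ∀ g, (M g).det ≠ 0)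
    (hmul : ∀ g h, ∃ s : ℚ, s ≠ 0 ∧ M (g * h) = s • (M g * M h)) :
    ∃ τ : ℂ, τ.im ≠ 0 ∧ ∀ g,
      M g 0 0 * τ + M g 0 1 = τ * (M g 1 0 * τ + M g 1 1) ∨
      M g 0 0 * τ + M g 0 1 = conj τ * (M g 1 0 * τ + M g 1 1) := by
  have := Fintype.ofFinite G
  have hq : ∃ A B C : ℝ, ∀ x y : ℂ, ∑ h, normForm (M h) x y = A * x ^ 2 + B * x * y + C * y ^ 2 := by
    refine ⟨∑ h, (M h 0 0 ^ 2 + M h 1 0 ^ 2 : ℝ) / (|(M h).det| : ℚ),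
      ∑ h, (2 * M h 0 0 * M h 0 1 + 2 * M h 1 0 * M h 1 1 : ℝ) / (|(M h).det| : ℚ),
      ∑ h, (M h 0 1 ^ 2 + M h 1 1 ^ 2 : ℝ) / (|(M h).det| : ℚ), fun x y ↦ ?_⟩
    simp only [Complex.ofReal_sum, Finset.sum_mul, ← Finset.sum_add_distrib]
    refine Finset.sum_congr rfl fun h _ ↦ ?_
    simp only [normForm]
    generalize |(M h).det| = δ
    push_cast
    ring
  have hpos {x y : ℝ} (hxy : x ≠ 0 ∨ y ≠ 0) : ∑ h, normForm (M h) (x : ℂ) y ≠ 0 := by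
    have h1 : 0 < ∑ h, normForm (M h) x y :=
      Finset.sum_pos (fun h _ ↦ normForm_pos (hdet h) hxy) Finset.univ_nonempty
    have h2 : ∑ h, normForm (M h) (x : ℂ) y = ((∑ h, normForm (M h) x y : ℝ) : ℂ) := by
      rw [Complex.ofReal_sum]
      refine Finset.sum_congr rfl fun h _ ↦ ?_
      simp only [normForm]
      generalize |(M h).det| = δ
      push_cast
      rfl
    rw [h2]
    exact_mod_cast h1.ne'
  have hinv (g : G) {x y : ℂ} (h0 : ∑ h, normForm (M h) x y = 0) :
      ∑ h, normForm (M h) (M g 0 0 * x + M g 0 1 * y) (M g 1 0 * x + M g 1 1 * y) = 0 := by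
    rw [← Equiv.sum_comp (Equiv.mulRight g)] at h0
    have h1 (h : G) : normForm (M (Equiv.mulRight g h)) x y = normForm (M h)
        (M g 0 0 * x + M g 0 1 * y) (M g 1 0 * x + M g 1 1 * y) / (|(M g).det| : ℚ) := by
      obtain ⟨s, hs, hgh⟩ := hmul h g
      rw [Equiv.coe_mulRight, hgh, normForm_smul_mul hs]
    simp only [h1, ← Finset.sum_div] at h0
    exact (div_eq_zero_iff.1 h0).resolve_right (by exact_mod_cast abs_ne_zero.2 (hdet g))
  obtain ⟨A, B, C, hABC⟩ := hq
  have hA : (A : ℂ) ≠ 0 := by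
    have := hpos (x := 1) (y := 0) (by simp)
    rw [hABC] at this
    simpa using this
  obtain ⟨s, hs⟩ := IsAlgClosed.exists_eq_mul_self (discrim (A : ℂ) B C)
  obtain ⟨τ, hτ⟩ := exists_quadratic_eq_zero hA ⟨s, hs⟩
  have hτim : τ.im ≠ 0 := fun him ↦ by
    have hre : ((τ.re : ℝ) : ℂ) = τ := by apply Complex.ext <;> simp [him]
    refine hpos (x := τ.re) (y := 1) (by simp) ?_
    rw [hABC, hre]
    push_cast
    linear_combination hτ
  have hτne : τ - conj τ ≠ 0 := fun h ↦
    hτim (Complex.conj_eq_iff_im.1 (sub_eq_zero.1 h).symm)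
  have hτ' : (A : ℂ) * (conj τ * conj τ) + B * conj τ + C = 0 := by
    simpa using congrArg conj hτ
  have hsum : A * (τ + conj τ) + B = 0 := by
    refine (mul_eq_zero.1 ?_).resolve_left hτne
    linear_combination hτ - hτ'
  refine ⟨τ, hτim, fun g ↦ ?_⟩
  have h := hinv g (x := τ) (y := 1) (by rw [hABC]; linear_combination hτ)
  rw [hABC, mul_one, mul_one] at h
  rw [← sub_eq_zero, ← sub_eq_zero (a := _ + _) (b := conj τ * _), ← mul_eq_zero,
    ← mul_right_inj' hA, mul_zero]
  generalize (M g 0 0 : ℂ) * τ + M g 0 1 = x at h ⊢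
  generalize (M g 1 0 : ℂ) * τ + M g 1 1 = y at h ⊢
  linear_combination h - x * y * hsum - y ^ 2 * hτ + τ * y ^ 2 * hsum

/-- A finite group with a faithful two-dimensional rational projective representation is cyclic or
dihedral, with rotation subgroup of order `1`, `2`, `3`, `4` or `6`. -/
theorem cyclic_or_dihedral_of_projective_rep (hdet : ∀ g, (M g).det ≠ 0)
    (hmul : ∀ g h, ∃ s : ℚ, s ≠ 0 ∧ M (g * h) = s • (M g * M h))
    (hker : ∀ g (c : ℚ), M g = c • (1 : Matrix (Fin 2) (Fin 2) ℚ) → g = 1) :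
    ∃ n ∈ ({1, 2, 3, 4, 6} : Set ℕ),
      Nonempty (G ≃* Multiplicative (ZMod n)) ∨ Nonempty (G ≃* DihedralGroup n) := by
  obtain ⟨τ, him, hfix⟩ := exists_conj_pair_fixed hdet hmul
  have hτ : conj τ ≠ τ := fun h ↦ him (Complex.conj_eq_iff_im.1 h)
  let j (g : G) : ℂ := M g 1 0 * τ + M g 1 1
  let ν (g : G) : ℂ := M g 0 0 * τ + M g 0 1
  let P (g : G) : Prop := ν g = τ * j g
  have hP' {g} (h : ¬ P g) : ν g = conj τ * j g := (hfix g).resolve_left h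
  have hjim (g) : (j g).im = M g 1 0 * τ.im := by simp [j]
  have hj (g) : j g ≠ 0 := fun h ↦ by
    have h1 : M g 1 0 = 0 := by
      have := hjim g
      rw [h] at this
      simpa [him] using this.symm
    have h2 : M g 1 1 = 0 := by simpa [j, h1] using h
    exact hdet g (by simp [det_fin_two, h1, h2])
  have hconj (g) : conj (j g) = M g 1 0 * conj τ + M g 1 1 := by simp [j]
  have hconjν (g) : conj (ν g) = M g 0 0 * conj τ + M g 0 1 := by simp [ν]
  have hreal {g} (hg : P g) (h : conj (j g) = j g) : g = 1 := by
    have h1 : M g 1 0 = 0 := by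
      have := hjim g
      rw [Complex.conj_eq_iff_im.1 h] at this
      simpa [him] using this.symm
    have h2 : (M g 0 0 : ℂ) * τ + M g 0 1 = τ * M g 1 1 := by simpa [P, ν, j, h1] using hg
    have h3 : M g 0 0 = M g 1 1 := by
      have := congrArg Complex.im h2
      simp only [Complex.add_im, Complex.mul_im, Complex.ratCast_im, Complex.ratCast_re] at this
      have : τ.im * (M g 0 0 - M g 1 1 : ℝ) = 0 := by linear_combination this
      have := (mul_eq_zero.1 this).resolve_left him
      exact_mod_cast sub_eq_zero.1 this
    have h4 : M g 0 1 = 0 := by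
      rw [h3] at h2
      have : (M g 0 1 : ℂ) = 0 := by linear_combination h2
      exact_mod_cast this
    refine hker g (M g 1 1) ?_
    ext i k
    fin_cases i <;> fin_cases k <;> simp [h1, h3, h4]
  have hjmul (g h) : ∃ s : ℚ, s ≠ 0 ∧ j (g * h) = s * (M g 1 0 * ν h + M g 1 1 * j h) ∧
      ν (g * h) = s * (M g 0 0 * ν h + M g 0 1 * j h) := by
    obtain ⟨s, hs, hgh⟩ := hmul g h
    refine ⟨s, hs, ?_, ?_⟩ <;>
    · simp only [j, ν, hgh, Matrix.smul_apply, mul_apply, Fin.sum_univ_two, smul_eq_mul]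
      push_cast
      ring
  have hjP (g) {h} (hh : P h) : ∃ s : ℚ, s ≠ 0 ∧ j (g * h) = s * (j g * j h) ∧
      ν (g * h) = s * (ν g * j h) := by
    obtain ⟨s, hs, h1, h2⟩ := hjmul g h
    refine ⟨s, hs, ?_, ?_⟩
    · rw [h1, hh]; ring
    · rw [h2, hh]; ring
  have hjnP (g) {h} (hh : ¬ P h) : ∃ s : ℚ, s ≠ 0 ∧ j (g * h) = s * (conj (j g) * j h) ∧
      ν (g * h) = s * (conj (ν g) * j h) := by
    obtain ⟨s, hs, h1, h2⟩ := hjmul g h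
    refine ⟨s, hs, ?_, ?_⟩
    · rw [h1, hP' hh, hconj]; ring
    · rw [h2, hP' hh, hconjν]; ring
  have hPmul (g h) : P (g * h) ↔ (P g ↔ P h) := by
    by_cases hh : P h
    · obtain ⟨s, hs, h1, h2⟩ := hjP g hh
      have hs' : (s : ℂ) * j h ≠ 0 := mul_ne_zero (by exact_mod_cast hs) (hj h)
      simp only [hh, iff_true]
      constructor
      · intro hgh
        refine mul_left_cancel₀ hs' ?_
        linear_combination hgh - h2 + τ * h1
      · intro hg
        change _ = _
        rw [h1, h2, hg]; ring
    · obtain ⟨s, hs, h1, h2⟩ := hjnP g hh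
      have hs' : (s : ℂ) * j h ≠ 0 := mul_ne_zero (by exact_mod_cast hs) (hj h)
      simp only [hh, iff_false]
      constructor
      · intro hgh hg
        have e : conj (ν g) = conj τ * conj (j g) := by rw [hg, map_mul]
        have hcj : conj (j g) ≠ 0 := (map_ne_zero _).2 (hj g)
        refine hτ (mul_right_cancel₀ hcj (mul_left_cancel₀ hs' ?_))
        change _ = _ at hgh
        rw [h1, h2, e] at hgh
        linear_combination hgh
      · intro hg
        have e : conj (ν g) = τ * conj (j g) := by rw [hP' hg, map_mul, Complex.conj_conj]
        change _ = _
        rw [h1, h2, e]; ring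
  have hP1 : P 1 := by
    have := hPmul 1 1
    rw [mul_one] at this
    exact this.2 Iff.rfl
  let N : Subgroup G :=
    { carrier := {g | P g}
      mul_mem' := fun {g h} hg hh ↦ (hPmul g h).2 (iff_of_true hg hh)
      one_mem' := hP1
      inv_mem' := fun {g} hg ↦ by
        have := hPmul g g⁻¹
        rw [mul_inv_cancel] at this
        exact (this.1 hP1).1 hg }
  let χ : N →* ℂˣ := MonoidHom.mk'
    (fun g ↦ Units.mk0 (conj (j g) / j g) (div_ne_zero ((map_ne_zero _).2 (hj _)) (hj _))) <| by
      intro g h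
      obtain ⟨s, hs, h1, -⟩ := hjP g h.2
      have hs' : (s : ℂ) ≠ 0 := by exact_mod_cast hs
      ext
      have := hj g
      have := hj h
      simp only [Units.val_mk0, Units.val_mul, Subgroup.coe_mul, h1, map_mul, map_ratCast]
      field_simp
  have hχ (g : N) : (χ g : ℂ) = conj (j g) / j g := rfl
  have hinj : Function.Injective χ := by
    rw [injective_iff_map_eq_one]
    intro g hg
    have h1 : conj (j g) / j g = 1 := by rw [← hχ, hg, Units.val_one]
    exact Subtype.ext (hreal g.2 ((div_eq_one_iff_eq (hj _)).1 h1))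
  have hcyc : IsCyclic N :=
    isCyclic_of_injective_ringHom ((Units.coeHom ℂ).comp χ) (Units.val_injective.comp hinj)
  have hcard : Nat.card N ∈ ({1, 2, 3, 4, 6} : Set ℕ) := by
    obtain ⟨g, hg⟩ := hcyc.exists_generator
    rw [← orderOf_eq_card_of_forall_mem_zpowers hg, ← orderOf_injective χ hinj g,
      ← orderOf_units]
    have htr : j g + conj (j g) = ((M g).trace : ℚ) := by
      have h1 : ν (g : G) = τ * j g := g.2
      have h2 := congrArg conj h1
      rw [map_mul, hconjν, hconj] at h2
      have h3 : (M g 0 0 : ℂ) - M g 1 1 = M g 1 0 * (τ + conj τ) := by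
        refine mul_right_cancel₀ (sub_ne_zero.2 hτ) ?_
        simp only [ν, j] at h1
        linear_combination h2 - h1
      rw [hconj, trace_fin_two]
      simp only [j]
      push_cast
      linear_combination -h3
    have hnm : j g * conj (j g) = ((M g).det : ℚ) := by
      have h1 : ν (g : G) = τ * j g := g.2
      rw [det_fin_two]
      push_cast
      rw [trace_fin_two] at htr
      push_cast at htr
      simp only [ν, j] at h1 htr ⊢
      rw [hconj] at htr ⊢
      linear_combination (M g 1 0 * τ + M g 1 1 : ℂ) * htr + (M g 1 0 : ℂ) * h1
    refine orderOf_mem_of_add_inv_rat (t := (M g).trace ^ 2 / (M g).det - 2) ?_ ?_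
    · exact ((Units.coeHom ℂ).comp χ).isOfFinOrder (isOfFinOrder_of_finite g)
    · have h1 := hj g
      have h2 : conj (j g) ≠ 0 := (map_ne_zero _).2 (hj _)
      rw [hχ, Rat.cast_sub, Rat.cast_div, Rat.cast_pow, Rat.cast_ofNat, ← htr, ← hnm]
      field_simp
      ring
  refine ⟨Nat.card N, hcard, ?_⟩
  by_cases htop : N = ⊤
  · refine Or.inl ⟨?_⟩
    have e : N ≃* G := (MulEquiv.subgroupCongr htop).trans Subgroup.topEquiv
    exact e.symm.trans (zmodCyclicMulEquiv hcyc).symm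
  · obtain ⟨x, hx⟩ : ∃ x, x ∉ N := by simpa [Subgroup.eq_top_iff'] using htop
    refine Or.inr (nonempty_mulEquiv_dihedralGroup N hx hPmul fun g hg ↦ ?_)
    obtain ⟨s, -, h1, -⟩ := hjnP g (h := g) hg
    refine hreal ((hPmul g g).2 Iff.rfl) ?_
    rw [h1, map_mul, map_mul, Complex.conj_conj, map_ratCast, mul_comm (j g)]

end ProjectiveRepresentation

namespace RatFunc

variable {K : Type*} [Field K]

theorem C_mul_X_sq_add_C_mul_X_add_C_eq_zero {a b c : K}
    (h : C a * X ^ 2 + C b * X + C c = (0 : RatFunc K)) : a = 0 ∧ b = 0 ∧ c = 0 := by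
  have h' : algebraMap (Polynomial K) (RatFunc K)
      (Polynomial.C a * Polynomial.X ^ 2 + Polynomial.C b * Polynomial.X + Polynomial.C c) = 0 := by
    simpa using h
  rw [map_eq_zero_iff _ (algebraMap_injective K)] at h'
  exact ⟨by simpa using congrArg (Polynomial.coeff · 2) h',
    by simpa [Polynomial.coeff_X] using congrArg (Polynomial.coeff · 1) h',
    by simpa using congrArg (Polynomial.coeff · 0) h'⟩

theorem C_mul_X_add_C_eq_zero {a b : K} (h : C a * X + C b = (0 : RatFunc K)) :
    a = 0 ∧ b = 0 :=
  (C_mul_X_sq_add_C_mul_X_add_C_eq_zero (a := 0) (by simpa using h)).2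

/-- Every automorphism of `K(X)` over `K` is a Möbius transformation. -/
theorem exists_mobius (σ : RatFunc K ≃ₐ[K] RatFunc K) :
    ∃ m : Matrix (Fin 2) (Fin 2) K, m.det ≠ 0 ∧
      C (m 0 0) * X + C (m 1 0) = σ X * (C (m 0 1) * X + C (m 1 1)) := by
  have hadj : IntermediateField.adjoin K {σ X} = ⊤ := by
    have h := IntermediateField.adjoin_map K {(X : RatFunc K)} (σ : RatFunc K →ₐ[K] RatFunc K)
    rw [adjoin_X, ← AlgHom.fieldRange_eq_map, Set.image_singleton] at h
    rw [show σ X = (σ : RatFunc K →ₐ[K] RatFunc K) X from rfl, ← h]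
    exact AlgHom.fieldRange_eq_top.2 σ.surjective
  have hdeg := finrank_eq_max_natDegree (σ X)
  rw [hadj, IntermediateField.finrank_top] at hdeg
  obtain ⟨a, b, hab⟩ := Polynomial.exists_eq_X_add_C_of_natDegree_le_one
    (p := (σ X).num) (by omega)
  obtain ⟨c, d, hcd⟩ := Polynomial.exists_eq_X_add_C_of_natDegree_le_one
    (p := (σ X).denom) (by omega)
  have hden : C c * X + C d ≠ (0 : RatFunc K) := fun h ↦ by
    obtain ⟨rfl, rfl⟩ := C_mul_X_add_C_eq_zero h
    exact (σ X).denom_ne_zero (by simpa using hcd)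
  have heq : C a * X + C b = σ X * (C c * X + C d) := by
    rw [← div_eq_iff hden]
    conv_rhs => rw [← num_div_denom (σ X), hab, hcd]
    simp
  refine ⟨!![a, c; b, d], fun h0 ↦ ?_, by simpa using heq⟩
  rw [det_fin_two_of] at h0
  have hconst : ∃ r : K, σ X = C r := by
    have hC : (C a * C d - C c * C b : RatFunc K) = 0 := by
      rw [← map_mul, ← map_mul, ← map_sub, h0, map_zero]
    by_cases hc : c = 0
    · have hd : C d ≠ (0 : RatFunc K) := by simpa [hc] using hden
      have ha : a = 0 := by
        rw [map_ne_zero] at hd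
        simpa [hc, hd] using h0
      refine ⟨b / d, ?_⟩
      rw [map_div₀, eq_div_iff hd]
      simpa [hc, ha] using heq.symm
    · have hc' : C c ≠ (0 : RatFunc K) := (map_ne_zero _).2 hc
      refine ⟨a / c, ?_⟩
      rw [map_div₀, eq_div_iff hc']
      refine mul_right_cancel₀ hden ?_
      linear_combination -C c * heq - hC
  obtain ⟨r, hr⟩ := hconst
  have hX : (X : RatFunc K) = C r := by
    apply σ.injective
    rw [hr, ← algebraMap_eq_C, AlgEquiv.commutes]
  have := C_mul_X_add_C_eq_zero (a := (1 : K)) (b := -r) (by rw [hX]; simp)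
  exact one_ne_zero this.1

/-- A matrix whose Möbius transformation fixes `X` is scalar. -/
theorem eq_smul_one_of_mobius_eq_X {m : Matrix (Fin 2) (Fin 2) K}
    (h : C (m 0 0) * X + C (m 1 0) = (X : RatFunc K) * (C (m 0 1) * X + C (m 1 1))) :
    m = m 0 0 • (1 : Matrix (Fin 2) (Fin 2) K) := by
  obtain ⟨h1, h2, h3⟩ := C_mul_X_sq_add_C_mul_X_add_C_eq_zero (K := K)
    (a := m 0 1) (b := m 1 1 - m 0 0) (c := -m 1 0) <| by
      rw [map_sub, map_neg]
      linear_combination -h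
  ext i k
  fin_cases i <;> fin_cases k
  · simp
  · simpa using h1
  · simpa using h3
  · simpa using sub_eq_zero.1 h2

/-- The matrix of a Möbius transformation is determined up to scaling. -/
theorem mobius_unique {m k : Matrix (Fin 2) (Fin 2) K} (hm : m.det ≠ 0) (hk : k.det ≠ 0)
    {u : RatFunc K} (hmu : C (m 0 0) * X + C (m 1 0) = u * (C (m 0 1) * X + C (m 1 1)))
    (hku : C (k 0 0) * X + C (k 1 0) = u * (C (k 0 1) * X + C (k 1 1))) :
    ∃ s : K, s ≠ 0 ∧ m = s • k := by
  have h := eq_smul_one_of_mobius_eq_X (m := m * k.adjugate) <| by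
    simp only [adjugate_fin_two, mul_apply, Fin.sum_univ_two, of_apply, cons_val', cons_val_zero,
      cons_val_one, cons_val_fin_one, map_add, map_mul, map_neg]
    linear_combination (C (k 1 1) + C (k 0 1) * X) * hmu -
      (C (m 0 1) * X + C (m 1 1)) * hku
  set s := (m * k.adjugate) 0 0
  have h' : k.det • m = s • k := by
    calc k.det • m = m * k.adjugate * k := by
          rw [Matrix.mul_assoc, adjugate_mul, Matrix.mul_smul, Matrix.mul_one]
      _ = s • k := by rw [h, Matrix.smul_mul, Matrix.one_mul]
  have hmk : m = (s / k.det) • k := by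
    rw [div_eq_inv_mul, mul_smul, ← h', smul_smul, inv_mul_cancel₀ hk, one_smul]
  refine ⟨_, fun h0 ↦ hm ?_, hmk⟩
  rw [hmk, h0, zero_smul, det_zero]

/-- Composition of automorphisms corresponds to multiplication of matrices. -/
theorem mobius_mul {σ τ : RatFunc K ≃ₐ[K] RatFunc K} {m k : Matrix (Fin 2) (Fin 2) K}
    (hm : C (m 0 0) * X + C (m 1 0) = σ X * (C (m 0 1) * X + C (m 1 1)))
    (hk : C (k 0 0) * X + C (k 1 0) = τ X * (C (k 0 1) * X + C (k 1 1))) :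
    C ((m * k) 0 0) * X + C ((m * k) 1 0) =
      (σ * τ) X * (C ((m * k) 0 1) * X + C ((m * k) 1 1)) := by
  have hC (r : K) : σ (C r) = C r := by rw [← algebraMap_eq_C, AlgEquiv.commutes]
  have hk' := congrArg σ hk
  simp only [map_add, map_mul, hC] at hk'
  simp only [AlgEquiv.mul_apply, mul_apply, Fin.sum_univ_two, map_add, map_mul]
  linear_combination (C (k 0 0) - σ (τ X) * C (k 0 1)) * hm +
    (C (m 0 1) * X + C (m 1 1)) * hk'

theorem algEquiv_eq_one {σ : RatFunc K ≃ₐ[K] RatFunc K} (h : σ X = X) : σ = 1 := by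
  ext f
  have hpoly (p : Polynomial K) :
      σ (algebraMap (Polynomial K) (RatFunc K) p) = algebraMap (Polynomial K) (RatFunc K) p := by
    have : (σ : RatFunc K →ₐ[K] RatFunc K).comp
        (IsScalarTower.toAlgHom K (Polynomial K) (RatFunc K)) =
        IsScalarTower.toAlgHom K (Polynomial K) (RatFunc K) := by
      ext
      simpa using h
    exact DFunLike.congr_fun this p
  rw [← num_div_denom f, map_div₀, hpoly, hpoly, AlgEquiv.one_apply]

end RatFunc

/-- `finite_subgroup_of_aut_ratFunc_rat` for an arbitrary `ℚ`-algebra structure: the instances on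
`RatFunc ℚ` as a field of characteristic zero and as a field of fractions are not reducibly equal. -/
theorem finite_subgroup_of_aut_ratFunc_rat_of_algebra
    [inst : Algebra ℚ (RatFunc ℚ)] (H : Subgroup (RatFunc ℚ ≃ₐ[ℚ] RatFunc ℚ)) [Finite H] :
    H = ⊥ ∨ ∃ n ∈ ({2, 3, 4, 6} : Set ℕ),
      Nonempty (H ≃* Multiplicative (ZMod n)) ∨ Nonempty (H ≃* DihedralGroup n) := by
  obtain rfl : inst = RatFunc.instAlgebraOfPolynomial ℚ ℚ := Subsingleton.elim _ _
  choose M hdet hM using fun h : H ↦ RatFunc.exists_mobius (K := ℚ) h.1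
  obtain ⟨n, hn, hiso⟩ := cyclic_or_dihedral_of_projective_rep hdet
    (fun g h ↦ RatFunc.mobius_unique (hdet _) (by
      rw [det_mul]
      exact mul_ne_zero (hdet g) (hdet h)) (hM (g * h)) (RatFunc.mobius_mul (hM g) (hM h)))
    (fun g c hg ↦ by
      have hc : c ≠ 0 := by
        rintro rfl
        exact hdet g (by rw [hg, zero_smul, det_zero])
      have hC : RatFunc.C c ≠ 0 := (map_ne_zero _).2 hc
      have h := hM g
      rw [hg] at h
      refine Subtype.ext (RatFunc.algEquiv_eq_one (mul_right_cancel₀ hC ?_))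
      simpa [mul_comm] using h.symm)
  rcases hn with rfl | hn
  · rcases hiso with ⟨⟨e⟩⟩ | ⟨⟨e⟩⟩
    · left
      have := e.toEquiv.subsingleton
      exact H.eq_bot_of_subsingleton
    · have hcard : Nat.card H = 2 := (Nat.card_congr e.toEquiv).trans DihedralGroup.nat_card
      exact Or.inr ⟨2, by simp, Or.inl ⟨mulEquivOfPrimeCardEq hcard (by simp)⟩⟩
  · exact Or.inr ⟨n, hn, hiso⟩

/-- Every finite subgroup of `Aut_ℚ ℚ(x) ≅ PGL₂(ℚ)` is trivial, cyclic of order `n`, or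
dihedral of order `2n`, for some `n ∈ {2, 3, 4, 6}`. -/
theorem finite_subgroup_of_aut_ratFunc_rat
    (H : Subgroup (RatFunc ℚ ≃ₐ[ℚ] RatFunc ℚ)) [Finite H] :
    H = ⊥ ∨ ∃ n ∈ ({2, 3, 4, 6} : Set ℕ),
      Nonempty (H ≃* Multiplicative (ZMod n)) ∨ Nonempty (H ≃* DihedralGroup n) := by
  exact finite_subgroup_of_aut_ratFunc_rat_of_algebra H
end
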